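/- arXiv:0905.4588 — 8 statements merged into one kernel-verified Lean document; each statement's English description precedes it below -/
import Mathlib

section
/- Let q = 2p with p ≥ 2 be an even integer, λ = 2cos(π/q), and let α ∈ (α₀, 1/2). Then 𝒯_α^p(A_0) = 𝒯_α^p(D_0) up to a set of two-dimensional Lebesgue measure zero. -/
open Real MeasureTheory Set
open scoped symmDiff

/-- The digit function `d_α(x) = ⌊|1/(λx)| + 1 − α⌋`. -/
noncomputable def rosenD (lam a x : ℝ) : ℤ := ⌊|1 / (lam * x)| + 1 - a⌋

/-- The α-Rosen map `T_α`. -/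
noncomputable def rosenT (lam a : ℝ) (x : ℝ) : ℝ :=
  if x = 0 then 0 else |1 / x| - lam * rosenD lam a x

/-- The planar map `𝒯_α(x,y) = (T_α(x), 1/(d_α(x)λ + ε(x)·y))`. -/
noncomputable def rosenTT (lam a : ℝ) (z : ℝ × ℝ) : ℝ × ℝ :=
  (rosenT lam a z.1, 1 / ((rosenD lam a z.1 : ℝ) * lam + Real.sign z.1 * z.2))

/-- The sequence `L_j` for even `q`. -/
noncomputable def Lseq (lam : ℝ) : ℕ → ℝ
  | 0 => 0
  | 1 => 1 / (lam + 1)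
  | n + 2 => 1 / (lam - Lseq lam (n + 1))

/-- `φ_j = T_{1/2}^j(−λ/2)`. -/
noncomputable def phi (lam : ℝ) (j : ℕ) : ℝ := (rosenT lam (1 / 2))^[j] (-(lam / 2))

/-- The Rosen natural-extension domain `Ω_{1/2}` for even `q = 2p`. -/
noncomputable def OmegaEven (lam : ℝ) (p : ℕ) : Set (ℝ × ℝ) :=
  (⋃ j ∈ Finset.Icc 1 (p - 1),
      Set.Ico (phi lam (j - 1)) (phi lam j) ×ˢ Set.Icc (0 : ℝ) (Lseq lam j))
  ∪ Set.Ico (0 : ℝ) (lam / 2) ×ˢ Set.Icc (0 : ℝ) 1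

/-- The region of changed digits `C`. -/
noncomputable def changedDigits (lam a : ℝ) (Om : Set (ℝ × ℝ)) : Set (ℝ × ℝ) :=
  {z ∈ Om | z.1 ≠ 0 ∧ z.1 ∈ Set.Ico ((a - 1) * lam) (a * lam) ∧
    z.1 ∈ Set.Ico ((1 / 2 - 1) * lam) (1 / 2 * lam) ∧
    rosenD lam a z.1 ≠ rosenD lam (1 / 2) z.1}

/-- The planar map is invariant under the point reflection at the origin. -/
theorem rosenTT_neg (lam a x y : ℝ) : rosenTT lam a (-x, -y) = rosenTT lam a (x, y) := by
  simp [rosenTT, rosenT, rosenD, Real.sign_neg, div_neg, mul_neg, abs_neg]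

/-- The planar map on a point whose first coordinate is negative and has digit `1`. -/
theorem rosenTT_neg_digit_one {lam a w y : ℝ} (hl : 0 < lam) (hw : 0 < w)
    (hlow : 1 < lam * (1 + a) * w) (hup : a * lam * w ≤ 1) :
    rosenTT lam a (-w, y) = (1 / w - lam, 1 / (lam - y)) := by
  have habs : |1 / (lam * -w)| = 1 / (lam * w) := by
    rw [mul_neg, div_neg, abs_neg, abs_of_pos (by positivity)]
  have hd : rosenD lam a (-w) = 1 := by
    rw [rosenD, habs, Int.floor_eq_iff]
    have h1 : a ≤ 1 / (lam * w) := by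
      rw [le_div_iff₀ (by positivity)]; linarith
    have h2 : 1 / (lam * w) < 1 + a := by
      rw [div_lt_iff₀ (by positivity)]; linarith
    constructor <;> push_cast <;> linarith
  have hx : |1 / (-w)| = 1 / w := by
    rw [div_neg, abs_neg, abs_of_pos (by positivity)]
  have hs : Real.sign (-w) = -1 := Real.sign_of_neg (by linarith)
  simp only [rosenTT, rosenT, hd, hs, hx]
  rw [if_neg (by linarith)]
  ext <;> simp [sub_eq_add_neg]

/-- Orbits along which all digits are `1` and all signs are `-1`, in terms of solutions of the
linear recurrence `u (j + 2) = λ u (j + 1) - u j`. -/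
theorem rosenTT_iterate_of_recurrence {lam a : ℝ} (hl : 0 < lam) {m k : ℕ → ℝ}
    (hm : ∀ j, m (j + 2) = lam * m (j + 1) - m j)
    (hk : ∀ j, k (j + 2) = lam * k (j + 1) - k j) (n : ℕ)
    (hm0 : ∀ j ≤ n, 0 < m j) (hlow : ∀ j < n, 0 < a * lam * m (j + 1) + m (j + 2))
    (hup : ∀ j < n, a * lam * m (j + 1) ≤ m j) (hk0 : ∀ j ≤ n, 0 < k (j + 1)) :
    (rosenTT lam a)^[n] (-(m 1 / m 0), k 0 / k 1) = (-(m (n + 1) / m n), k n / k (n + 1)) := by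
  induction n with
  | zero => rfl
  | succ n ih =>
    rw [Function.iterate_succ_apply', ih (fun j hj => hm0 j (by omega))
      (fun j hj => hlow j (by omega)) (fun j hj => hup j (by omega))
      (fun j hj => hk0 j (by omega))]
    have h0 := hm0 n (by omega)
    have h1 := hm0 (n + 1) le_rfl
    have k1 := hk0 n (by omega)
    have k2 := hk0 (n + 1) le_rfl
    have hlo := hlow n (by omega)
    have hu := hup n (by omega)
    rw [rosenTT_neg_digit_one hl (by positivity)
      (by rw [← mul_div_assoc, lt_div_iff₀ h0]; linarith [hm n])
      (by rw [← mul_div_assoc, div_le_iff₀ h0]; linarith)]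
    rw [show n + 1 + 1 = n + 2 from rfl] at k2 ⊢
    ext
    · simp only
      rw [hm n]
      field_simp
      ring
    · have hne : lam - k n / k (n + 1) = k (n + 2) / k (n + 1) := by
        rw [hk n]; field_simp
      simp only [hne, one_div_div]

theorem sin_recurrence (θ t : ℝ) :
    Real.sin ((t + 2) * θ) = 2 * Real.cos θ * Real.sin ((t + 1) * θ) - Real.sin (t * θ) := by
  rw [show (t + 2) * θ = (t + 1) * θ + θ by ring, show t * θ = (t + 1) * θ - θ by ring,
    Real.sin_add, Real.sin_sub]
  ring

/-- The linear recurrence solution `j ↦ sin (jθ) u - sin ((j - 1)θ) v`. -/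
noncomputable def sinSeq (θ u v : ℝ) (j : ℕ) : ℝ :=
  Real.sin (j * θ) * u - Real.sin ((j - 1) * θ) * v

theorem sinSeq_recurrence (θ u v : ℝ) (j : ℕ) :
    sinSeq θ u v (j + 2) = 2 * Real.cos θ * sinSeq θ u v (j + 1) - sinSeq θ u v j := by
  have h1 := sin_recurrence θ j
  have h2 := sin_recurrence θ (j - 1)
  simp only [sinSeq]
  push_cast
  rw [h1, show ((j : ℝ) + 2 - 1) * θ = ((j : ℝ) - 1 + 2) * θ by ring, h2]
  ring_nf

theorem sinSeq_zero (θ u v : ℝ) : sinSeq θ u v 0 = Real.sin θ * v := by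
  simp [sinSeq]

theorem sinSeq_one (θ u v : ℝ) : sinSeq θ u v 1 = Real.sin θ * u := by
  simp [sinSeq]

/-- The quadratic invariant of the recurrence is positive definite, so ratios of consecutive terms
are nonincreasing. -/
theorem sinSeq_mul_le_sq (θ u v : ℝ) (j : ℕ) :
    sinSeq θ u v (j + 2) * sinSeq θ u v j ≤ sinSeq θ u v (j + 1) ^ 2 := by
  induction j with
  | zero =>
    rw [sinSeq_recurrence, zero_add, sinSeq_zero, sinSeq_one]
    have h : 0 ≤ (u - Real.cos θ * v) ^ 2 + (Real.sin θ * v) ^ 2 := by positivity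
    have h' : (u - Real.cos θ * v) ^ 2 + (Real.sin θ * v) ^ 2
        = u ^ 2 - 2 * Real.cos θ * u * v + v ^ 2 := by
      linear_combination v ^ 2 * Real.sin_sq_add_cos_sq θ
    rw [h'] at h
    nlinarith [mul_nonneg (sq_nonneg (Real.sin θ)) h]
  | succ n ih =>
    have h1 := sinSeq_recurrence θ u v n
    have h2 := sinSeq_recurrence θ u v (n + 1)
    rw [show n + 1 + 2 = n + 3 from rfl, show n + 1 + 1 = n + 2 from rfl] at *
    have : sinSeq θ u v (n + 2) ^ 2 - sinSeq θ u v (n + 3) * sinSeq θ u v (n + 1)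
        = sinSeq θ u v (n + 1) ^ 2 - sinSeq θ u v (n + 2) * sinSeq θ u v n := by
      linear_combination (sinSeq θ u v (n + 2)) * h1 - (sinSeq θ u v (n + 1)) * h2
    linarith

section Angle

variable {p : ℕ} {θ : ℝ}

theorem sin_natCast_mul_nonneg (hp : 2 ≤ p) (hθ : θ = Real.pi / (2 * p)) {j : ℕ}
    (hj : j ≤ 2 * p) : 0 ≤ Real.sin (j * θ) := by
  have hp' : (0 : ℝ) < 2 * p := by positivity
  have hjr : (j : ℝ) ≤ 2 * p := by exact_mod_cast hj
  apply Real.sin_nonneg_of_nonneg_of_le_pi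
  · rw [hθ]; positivity
  · rw [hθ, ← mul_div_assoc, div_le_iff₀ hp']
    nlinarith [Real.pi_pos]

theorem sin_natCast_mul_pos (hp : 2 ≤ p) (hθ : θ = Real.pi / (2 * p)) {j : ℕ}
    (hj0 : 0 < j) (hj : j < 2 * p) : 0 < Real.sin (j * θ) := by
  have hp' : (0 : ℝ) < 2 * p := by positivity
  have hjr : (j : ℝ) < 2 * p := by exact_mod_cast hj
  apply Real.sin_pos_of_pos_of_lt_pi
  · rw [hθ]; positivity
  · rw [hθ, ← mul_div_assoc, div_lt_iff₀ hp']
    nlinarith [Real.pi_pos]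

theorem natCast_mul_angle (hp : 2 ≤ p) (hθ : θ = Real.pi / (2 * p)) :
    (p : ℝ) * θ = Real.pi / 2 := by
  have : (p : ℝ) ≠ 0 := by positivity
  rw [hθ]; field_simp

theorem angle_mem (hp : 2 ≤ p) (hθ : θ = Real.pi / (2 * p)) : 0 < θ ∧ θ < Real.pi / 2 := by
  have h := natCast_mul_angle hp hθ
  have hp' : (2 : ℝ) ≤ p := by exact_mod_cast hp
  have h0 : 0 < θ := by rw [hθ]; positivity
  exact ⟨h0, by nlinarith⟩

theorem sinSeq_half (hp : 2 ≤ p) (hθ : θ = Real.pi / (2 * p)) (u v : ℝ) :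
    sinSeq θ u v p = u - Real.cos θ * v := by
  have h := natCast_mul_angle hp hθ
  rw [sinSeq, sub_mul, h, one_mul, Real.sin_pi_div_two, Real.sin_pi_div_two_sub, one_mul]

theorem sinSeq_half_sub_one (hp : 2 ≤ p) (hθ : θ = Real.pi / (2 * p)) (u v : ℝ) :
    sinSeq θ u v (p - 1) = Real.cos θ * u - (2 * Real.cos θ ^ 2 - 1) * v := by
  have h := natCast_mul_angle hp hθ
  rw [sinSeq, Nat.cast_sub (by omega), Nat.cast_one,
    show ((p : ℝ) - 1 - 1) * θ = Real.pi / 2 - 2 * θ by linarith,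
    show ((p : ℝ) - 1) * θ = Real.pi / 2 - θ by linarith, Real.sin_pi_div_two_sub,
    Real.sin_pi_div_two_sub, Real.cos_two_mul]

/-- Positivity of the denominators governing the second coordinate. -/
theorem sinSeq_one_pos (hp : 2 ≤ p) (hθ : θ = Real.pi / (2 * p)) {y : ℝ}
    (hy : 2 * Real.cos θ * y < 1) {j : ℕ} (hj : j < p) : 0 < sinSeq θ 1 y (j + 1) := by
  have hc : 0 < Real.cos θ := Real.cos_pos_of_mem_Ioo
    ⟨by linarith [(angle_mem hp hθ).1, Real.pi_pos], (angle_mem hp hθ).2⟩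
  have h1 := sin_natCast_mul_pos hp hθ (j := j + 1) (by omega) (by omega)
  have h0 := sin_natCast_mul_nonneg hp hθ (j := j) (by omega)
  have h2 := sin_natCast_mul_pos hp hθ (j := j + 2) (by omega) (by omega)
  have hr := sin_recurrence θ j
  rw [sinSeq]
  push_cast at *
  rw [add_sub_cancel_right]
  have : 0 < 2 * Real.cos θ * (Real.sin ((j + 1) * θ) * 1 - Real.sin (j * θ) * y) := by
    nlinarith
  exact pos_of_mul_pos_right this (by positivity)

theorem Lseq_eq_sinSeq (hp : 2 ≤ p) (hθ : θ = Real.pi / (2 * p)) {j : ℕ} (hj : j < p) :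
    Lseq (2 * Real.cos θ) (j + 1)
      = sinSeq θ 1 (1 / (2 * Real.cos θ + 1)) j / sinSeq θ 1 (1 / (2 * Real.cos θ + 1)) (j + 1) := by
  have hc : 0 < Real.cos θ := Real.cos_pos_of_mem_Ioo
    ⟨by linarith [(angle_mem hp hθ).1, Real.pi_pos], (angle_mem hp hθ).2⟩
  have hy : 2 * Real.cos θ * (1 / (2 * Real.cos θ + 1)) < 1 := by
    rw [mul_one_div, div_lt_one (by positivity)]; linarith
  induction j with
  | zero =>
    have hs : 0 < Real.sin θ := Real.sin_pos_of_pos_of_lt_pi (angle_mem hp hθ).1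
      (by linarith [(angle_mem hp hθ).2, Real.pi_pos])
    rw [zero_add, sinSeq_zero, sinSeq_one, Lseq, mul_div_mul_left _ _ hs.ne', div_one]
  | succ j ih =>
    have h1 := sinSeq_one_pos hp hθ hy (j := j) (by omega)
    rw [show j + 1 + 1 = j + 2 from rfl, Lseq, ih (by omega), sinSeq_recurrence, sub_div' h1.ne',
      one_div_div]

theorem Lseq_lt (hp : 2 ≤ p) (hθ : θ = Real.pi / (2 * p)) {j : ℕ} (hj0 : 1 ≤ j)
    (hj : j ≤ p - 1) : Lseq (2 * Real.cos θ) j < 2 * Real.cos θ := by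
  have hc : 0 < Real.cos θ := Real.cos_pos_of_mem_Ioo
    ⟨by linarith [(angle_mem hp hθ).1, Real.pi_pos], (angle_mem hp hθ).2⟩
  have hy : 2 * Real.cos θ * (1 / (2 * Real.cos θ + 1)) < 1 := by
    rw [mul_one_div, div_lt_one (by positivity)]; linarith
  obtain ⟨i, rfl⟩ : ∃ i, j = i + 1 := ⟨j - 1, by omega⟩
  have h1 := sinSeq_one_pos hp hθ hy (j := i) (by omega)
  have h2 := sinSeq_one_pos hp hθ hy (j := i + 1) (by omega)
  rw [Lseq_eq_sinSeq hp hθ (by omega), div_lt_iff₀ h1]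
  rw [show i + 1 + 1 = i + 2 from rfl, sinSeq_recurrence] at h2
  linarith

/-- The quadratic inequality equivalent to `α₀ < α`. -/
theorem quadratic_pos_of_lt {lam a : ℝ} (hl : 0 < lam)
    (ha0 : (lam ^ 2 - 4 + Real.sqrt ((4 - lam ^ 2) ^ 2 + 4 * lam ^ 2)) / (2 * lam ^ 2) < a) :
    0 < lam ^ 2 * a ^ 2 + (4 - lam ^ 2) * a - 1 := by
  rw [div_lt_iff₀ (by positivity)] at ha0
  have h : Real.sqrt ((4 - lam ^ 2) ^ 2 + 4 * lam ^ 2) < 2 * lam ^ 2 * a + (4 - lam ^ 2) := by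
    linarith
  have h2 := Real.lt_sq_of_sqrt_lt h
  have h3 : 0 < 4 * lam ^ 2 * (lam ^ 2 * a ^ 2 + (4 - lam ^ 2) * a - 1) := by nlinarith
  exact pos_of_mul_pos_right h3 (by positivity)

theorem pos_of_lt {lam a : ℝ} (hl : 0 < lam)
    (ha0 : (lam ^ 2 - 4 + Real.sqrt ((4 - lam ^ 2) ^ 2 + 4 * lam ^ 2)) / (2 * lam ^ 2) < a) :
    0 < a := by
  refine lt_of_le_of_lt (div_nonneg ?_ (by positivity)) ha0
  have : 4 - lam ^ 2 ≤ Real.sqrt ((4 - lam ^ 2) ^ 2 + 4 * lam ^ 2) :=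
    Real.le_sqrt_of_sq_le (by nlinarith)
  linarith

/-- The first `p - 1` iterates of `𝒯_α` at points with first coordinate between `-(1 - α)λ` and
`-αλ`. -/
theorem rosenTT_iterate_half (hp : 2 ≤ p) (hθ : θ = Real.pi / (2 * p)) {lam a w y : ℝ}
    (hlam : lam = 2 * Real.cos θ) (ha : 0 < a) (ha1 : a < 1 / 2)
    (hquad : 0 < lam ^ 2 * a ^ 2 + (4 - lam ^ 2) * a - 1)
    (hw : a * lam ≤ w) (hw' : w ≤ (1 - a) * lam) (hy : lam * y < 1) :
    (rosenTT lam a)^[p - 1] (-w, y)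
      = (-((2 * w - lam) / (lam * w - (lam ^ 2 - 2))),
          (lam - (lam ^ 2 - 2) * y) / (2 - lam * y))
      ∧ 0 < lam * w - (lam ^ 2 - 2) := by
  obtain ⟨hθ0, hθ1⟩ := angle_mem hp hθ
  have hc : 0 < Real.cos θ := Real.cos_pos_of_mem_Ioo ⟨by linarith, hθ1⟩
  have hs : 0 < Real.sin θ := Real.sin_pos_of_pos_of_lt_pi hθ0 (by linarith)
  have hl : 0 < lam := by rw [hlam]; positivity
  have hl2 : lam ^ 2 < 4 := by
    rw [hlam]; nlinarith [Real.sin_sq_add_cos_sq θ, sq_pos_of_pos hs]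
  have hcos : Real.cos θ = lam / 2 := by linarith
  have hbase : 0 < lam * w - (lam ^ 2 - 2) := by
    have h1 : 0 < a * (lam * (a * lam) - (lam ^ 2 - 2)) := by nlinarith
    have h2 := pos_of_mul_pos_right h1 ha.le
    nlinarith
  refine ⟨?_, hbase⟩
  set m := sinSeq θ w 1 with hm
  set k := sinSeq θ 1 y with hk
  have hmr : ∀ j, m (j + 2) = lam * m (j + 1) - m j := by
    rw [hlam]; exact sinSeq_recurrence θ w 1
  have hkr : ∀ j, k (j + 2) = lam * k (j + 1) - k j := by
    rw [hlam]; exact sinSeq_recurrence θ 1 y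
  have hmp : m p = w - lam / 2 := by rw [hm, sinSeq_half hp hθ, hcos, mul_one]
  have hmp1 : m (p - 1) = (lam * w - (lam ^ 2 - 2)) / 2 := by
    rw [hm, sinSeq_half_sub_one hp hθ, hcos]; ring
  have hkp : k p = 1 - lam / 2 * y := by rw [hk, sinSeq_half hp hθ, hcos]
  have hkp1 : k (p - 1) = (lam - (lam ^ 2 - 2) * y) / 2 := by
    rw [hk, sinSeq_half_sub_one hp hθ, hcos]; ring
  have hsq : ∀ j, m (j + 2) * m j ≤ m (j + 1) ^ 2 := sinSeq_mul_le_sq θ w 1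
  have hpos : ∀ j ≤ p - 1, 0 < m j := by
    intro j hj
    have hpp : 0 < Real.sin ((p - 1 : ℕ) * θ) :=
      sin_natCast_mul_pos hp hθ (by omega) (by omega)
    induction hj using Nat.decreasingInduction with
    | self => rw [hmp1]; linarith
    | of_succ i hi ih =>
      have h1 := sin_natCast_mul_pos hp hθ (j := i + 1) (by omega) (by omega)
      rcases Nat.eq_zero_or_pos i with rfl | hi0
      · rw [hm, sinSeq_zero]; linarith
      · have h2 := sin_natCast_mul_pos hp hθ (j := i) hi0 (by omega)
        have hst := sinSeq_mul_le_sq θ 1 0 i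
        have e1 : Real.sin ((i - 1 : ℝ) * θ) = 2 * Real.cos θ * Real.sin (i * θ)
            - Real.sin ((i + 1 : ℝ) * θ) := by
          have := sin_recurrence θ (i - 1)
          rw [show (i - 1 + 2 : ℝ) = i + 1 by ring, show (i - 1 + 1 : ℝ) = i by ring] at this
          linarith
        have e2 := sin_recurrence θ i
        simp only [hm, sinSeq] at ih hst ⊢
        push_cast at *
        rw [add_sub_cancel_right] at ih
        rw [e2] at hst
        rw [e1]
        have : 0 < Real.sin ((i + 1) * θ) * (Real.sin (i * θ) * w
            - (2 * Real.cos θ * Real.sin (i * θ) - Real.sin ((i + 1) * θ)) * 1) := by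
          nlinarith
        exact pos_of_mul_pos_right this h1.le
  have hlow : ∀ j ≤ p - 1, 0 < a * lam * m j + m (j + 1) := by
    intro j hj
    induction hj using Nat.decreasingInduction with
    | self =>
      rw [show p - 1 + 1 = p by omega, hmp1, hmp]
      nlinarith [mul_nonneg (mul_pos ha hl).le (mul_nonneg hl.le (sub_nonneg.2 hw)),
        mul_pos hl hquad]
    | of_succ i hi ih =>
      have h0 := hpos i (by omega)
      have h1 := hpos (i + 1) (by omega)
      have : 0 < m (i + 1) * (a * lam * m i + m (i + 1)) := by
        nlinarith [hsq i, mul_pos h0 ih]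
      exact pos_of_mul_pos_right this h1.le
  have hup : ∀ j < p - 1, a * lam * m (j + 1) ≤ m j := by
    intro j hj
    induction j with
    | zero =>
      rw [hm, zero_add, sinSeq_one, sinSeq_zero]
      have h1 : a * lam * w ≤ 1 := by
        have h2 : a * lam * w ≤ a * lam * ((1 - a) * lam) := by gcongr
        nlinarith [sq_nonneg (a - 1 / 2), sq_nonneg lam]
      nlinarith
    | succ i ih =>
      have h0 := hpos i (by omega)
      have h1 := hpos (i + 1) (by omega)
      have hi := ih (by omega)
      have : 0 ≤ m i * (m (i + 1) - a * lam * m (i + 2)) := by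
        nlinarith [mul_le_mul_of_nonneg_left (hsq i) (mul_pos ha hl).le,
          mul_le_mul_of_nonneg_right hi h1.le]
      linarith [nonneg_of_mul_nonneg_right this h0]
  have key := rosenTT_iterate_of_recurrence (a := a) hl hmr hkr (p - 1) hpos
    (fun j hj => hlow (j + 1) (by omega)) hup
    (fun j hj => sinSeq_one_pos hp hθ (by rwa [← hlam]) (by omega))
  rw [show p - 1 + 1 = p by omega, hmp, hmp1, hkp, hkp1] at key
  have e0 : m 1 / m 0 = w := by
    rw [hm, sinSeq_one, sinSeq_zero, mul_one, mul_div_cancel_left₀ _ hs.ne']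
  have e1 : k 0 / k 1 = y := by
    rw [hk, sinSeq_one, sinSeq_zero, mul_one, mul_div_cancel_left₀ _ hs.ne']
  rw [e0, e1] at key
  rw [key]
  rw [show 1 - lam / 2 * y = (2 - lam * y) / 2 by ring,
    show w - lam / 2 = (2 * w - lam) / 2 by ring, div_div_div_cancel_right₀ two_ne_zero,
    div_div_div_cancel_right₀ two_ne_zero]

end Angle

/-- Two points on opposite sides of the vertical axis with the same image, with digits differing by
one. -/
theorem rosenTT_eq_of_add {lam a l r y y' : ℝ} (hlam : 0 < lam) (hl : 0 < l) (hr : 0 < r)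
    (hlr : 1 / l = 1 / r + lam) (hy : y' = lam - y) :
    rosenTT lam a (-l, y') = rosenTT lam a (r, y) := by
  have hD : rosenD lam a (-l) = rosenD lam a r + 1 := by
    rw [rosenD, rosenD, mul_neg, div_neg, abs_neg, abs_of_pos (by positivity),
      abs_of_pos (by positivity), ← Int.floor_add_one]
    congr 1
    have hdiv : 1 / (lam * l) = 1 / (lam * r) + 1 := by
      calc 1 / (lam * l) = 1 / l / lam := by field_simp
        _ = 1 / (lam * r) + 1 := by rw [hlr]; field_simp
    rw [hdiv]; ring
  have hs : Real.sign (-l) = -1 := Real.sign_of_neg (by linarith)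
  have hs' : Real.sign r = 1 := Real.sign_of_pos hr
  have hal : |1 / (-l)| = 1 / l := by rw [div_neg, abs_neg, abs_of_pos (by positivity)]
  have har : |1 / r| = 1 / r := abs_of_pos (by positivity)
  simp only [rosenTT, rosenT, hD, hs, hs', hal, har, hy]
  rw [if_neg (by linarith), if_neg hr.ne', hlr]
  push_cast
  ext
  · simp only; ring
  · simp only; congr 1; ring

/-- The points of `D₀` and `A₀` coming from the same point have the same image under `𝒯_α^p`. -/
theorem rosenTT_iterate_changed {p : ℕ} {lam a x y : ℝ} (hp : 2 ≤ p)
    (hlam : lam = 2 * Real.cos (Real.pi / (2 * p))) (ha : 0 < a) (ha1 : a < 1 / 2)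
    (hquad : 0 < lam ^ 2 * a ^ 2 + (4 - lam ^ 2) * a - 1)
    (hz : (x, y) ∈ changedDigits lam a (OmegaEven lam p)) :
    (rosenTT lam a)^[p] (rosenTT lam a (x, y)) =
      (rosenTT lam a)^[p] (rosenTT lam (1 / 2) (x, y)) := by
  obtain ⟨hθ0, hθ1⟩ := angle_mem hp rfl
  set θ := Real.pi / (2 * p) with hθ
  have hc : 0 < Real.cos θ := Real.cos_pos_of_mem_Ioo ⟨by linarith, hθ1⟩
  have hs : 0 < Real.sin θ := Real.sin_pos_of_pos_of_lt_pi hθ0 (by linarith)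
  have hl : 0 < lam := by rw [hlam]; positivity
  have hl2 : lam ^ 2 < 4 := by
    rw [hlam]; nlinarith [Real.sin_sq_add_cos_sq θ, sq_pos_of_pos hs]
  obtain ⟨hΩ, hx0, -, ⟨hxl, hxr⟩, hne⟩ := hz
  simp only at hx0 hxl hxr hne
  have hy : 0 ≤ y ∧ (y < lam ∨ 0 ≤ x) := by
    rcases hΩ with h | ⟨h1, h2⟩
    · simp only [mem_iUnion] at h
      obtain ⟨j, hj, h1, h2⟩ := h
      rw [Finset.mem_Icc] at hj
      refine ⟨h2.1, Or.inl (h2.2.trans_lt ?_)⟩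
      rw [hlam]
      exact Lseq_lt hp hθ hj.1 hj.2
    · exact ⟨h2.1, Or.inr h1.1⟩
  have hxa : 0 < |x| := abs_pos.2 hx0
  have hxb : |x| ≤ lam / 2 := abs_le.2 ⟨by linarith, by linarith⟩
  set u := 1 / (lam * |x|) with hu
  have hu1 : 1 / 2 < u := by
    rw [hu, lt_div_iff₀ (by positivity)]; nlinarith
  have hux : |1 / x| = lam * u := by
    rw [hu, abs_div, abs_one]; field_simp
  have hDu : ∀ b, rosenD lam b x = ⌊u + 1 - b⌋ := by
    intro b; rw [rosenD, abs_div, abs_mul, abs_one, abs_of_pos hl]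
  set d := rosenD lam (1 / 2) x with hd
  have hd1 := Int.floor_le (u + 1 - 1 / 2)
  have hd2 := Int.lt_floor_add_one (u + 1 - 1 / 2)
  have he1 := Int.floor_le (u + 1 - a)
  have he2 := Int.lt_floor_add_one (u + 1 - a)
  rw [← hDu] at hd1 hd2 he1 he2
  rw [← hd] at hd1 hd2
  have hda : rosenD lam a x = d + 1 := by
    have h1 : d < rosenD lam a x + 1 := by
      rw [← Int.cast_lt (R := ℝ)]; push_cast; linarith
    have h2 : rosenD lam a x < d + 2 := by
      rw [← Int.cast_lt (R := ℝ)]; push_cast; linarith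
    omega
  have hdpos : 1 ≤ d := by
    have : (0 : ℤ) < d := by
      rw [hd, hDu, Int.lt_iff_add_one_le, Int.le_floor]; push_cast; linarith
    omega
  have hdR : (1 : ℝ) ≤ d := by exact_mod_cast hdpos
  rw [hda] at he1
  push_cast at he1
  have hsgn : 0 < d * lam + Real.sign x * y := by
    rcases lt_or_gt_of_ne hx0 with h | h
    · rw [Real.sign_of_neg h]
      rcases hy.2 with h' | h'
      · nlinarith
      · linarith
    · rw [Real.sign_of_pos h]; nlinarith [hy.1]
  set D := d * lam + Real.sign x * y with hD
  set r := lam * u - lam * d with hr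
  have hr1 : a * lam ≤ r := by rw [hr]; nlinarith
  have hr2 : r < lam / 2 := by rw [hr]; nlinarith
  have hTD : rosenTT lam (1 / 2) (x, y) = (r, 1 / D) := by
    simp only [rosenTT, rosenT, if_neg hx0, hux, ← hd, hr, hD]
  have hTA : rosenTT lam a (x, y) = (-(lam - r), 1 / (D + lam)) := by
    simp only [rosenTT, rosenT, if_neg hx0, hux, hda, hr, hD]
    push_cast
    ext
    · simp only; ring
    · simp only; congr 1; ring
  have hflip : (rosenTT lam a)^[p - 1] (r, 1 / D) = (rosenTT lam a)^[p - 1] (-r, -(1 / D)) := by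
    obtain ⟨n, hn⟩ : ∃ n, p - 1 = n + 1 := ⟨p - 2, by omega⟩
    rw [hn, Function.iterate_succ_apply, Function.iterate_succ_apply, rosenTT_neg]
  obtain ⟨hA, hA0⟩ := rosenTT_iterate_half (y := 1 / (D + lam)) (w := lam - r) hp hθ hlam ha ha1
    hquad (by nlinarith) (by linarith)
    (by rw [mul_one_div, div_lt_one (by positivity)]; linarith)
  have hDneg : lam * -(1 / D) < 1 := by
    have : 0 < lam * (1 / D) := by positivity
    linarith
  obtain ⟨hB, hB0⟩ := rosenTT_iterate_half (y := -(1 / D)) (w := r) hp hθ hlam ha ha1 hquad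
    hr1 (by nlinarith) hDneg
  rw [show p = p - 1 + 1 by omega, Function.iterate_succ_apply', Function.iterate_succ_apply', hTD,
    hTA, hflip, hA, hB, ← neg_div (lam * r - (lam ^ 2 - 2)) (2 * r - lam), neg_sub (2 * r) lam]
  have hlr : 0 < lam - 2 * r := by linarith
  have hlr' : 0 < 2 * (lam - r) - lam := by linarith
  apply rosenTT_eq_of_add hl (div_pos hlr' hA0) (div_pos hlr hB0)
  · rw [one_div_div, one_div_div, show 2 * (lam - r) - lam = lam - 2 * r by ring,
      div_add' _ _ _ hlr.ne']
    congr 1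
    ring
  · have h1 : 0 < 2 * D + lam := by positivity
    have e1 : (lam - (lam ^ 2 - 2) * (1 / (D + lam))) / (2 - lam * (1 / (D + lam)))
        = (lam * D + 2) / (2 * D + lam) := by
      have h2 : 2 - lam * (1 / (D + lam)) = (2 * D + lam) / (D + lam) := by field_simp; ring
      rw [h2]; field_simp; ring
    have e2 : (lam - (lam ^ 2 - 2) * -(1 / D)) / (2 - lam * -(1 / D))
        = (lam * D + (lam ^ 2 - 2)) / (2 * D + lam) := by
      have h2 : 2 - lam * -(1 / D) = (2 * D + lam) / D := by field_simp; ring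
      rw [h2]; field_simp; ring
    rw [e1, e2]; field_simp; ring

/-- for even `q = 2p`, `α ∈ (α₀, 1/2)`, `𝒯_α^p(A₀) = 𝒯_α^p(D₀)` up to a set of
two-dimensional Lebesgue measure zero, where `A₀ = 𝒯_α(C)` and `D₀ = 𝒯_{1/2}(C)`. -/
theorem stmt1 (p q : ℕ) (hp : 2 ≤ p) (hq : q = 2 * p)
    (lam : ℝ) (hlam : lam = 2 * Real.cos (Real.pi / (q : ℝ)))
    (a : ℝ)
    (ha0 : (lam ^ 2 - 4 + Real.sqrt ((4 - lam ^ 2) ^ 2 + 4 * lam ^ 2)) / (2 * lam ^ 2) < a)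
    (ha1 : a < 1 / 2) :
    volume
      (((rosenTT lam a)^[p] '' (rosenTT lam a '' changedDigits lam a (OmegaEven lam p))) ∆
        ((rosenTT lam a)^[p] '' (rosenTT lam (1 / 2) '' changedDigits lam a (OmegaEven lam p))))
      = 0 := by
  have hlam' : lam = 2 * Real.cos (Real.pi / (2 * p)) := by
    rw [hlam, hq]; push_cast; rfl
  have hl : 0 < lam := by
    obtain ⟨h0, h1⟩ := angle_mem hp rfl
    have := Real.cos_pos_of_mem_Ioo ⟨by linarith [Real.pi_pos], h1⟩
    rw [hlam']; positivity
  have heq : (rosenTT lam a)^[p] '' (rosenTT lam a '' changedDigits lam a (OmegaEven lam p)) =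
      (rosenTT lam a)^[p] '' (rosenTT lam (1 / 2) '' changedDigits lam a (OmegaEven lam p)) := by
    rw [image_image, image_image]
    exact image_congr fun z hz => rosenTT_iterate_changed hp hlam' (pos_of_lt hl ha0) ha1
      (quadratic_pos_of_lt hl ha0) hz
  rw [heq, symmDiff_self, bot_eq_empty, measure_empty]
end

section
/- Let q = 2p with p ≥ 2 be an even integer, λ = 2cos(π/q), and let α ∈ (α₀, 1/2]. Then for every integer j with 0 ≤ j ≤ p−2 one has T_α^j((α−1)λ) < 0 with d_α(T_α^j((α−1)λ)) = 1, and also T_α^j(−αλ) < 0 with d_α(T_α^j(−αλ)) = 1; that is, the T_α-expansions of both l_0 and −r_0 begin with p−1 digits (−1 : 1). -/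
open Real MeasureTheory Set

/-- On `[(a - 1) lam, -1 / (lam (1 + a)))` the digit is `1`. -/
theorem rosenD_eq_one {lam a x : ℝ} (hl : 0 < lam) (hl2 : lam < 2)
    (ha1 : a ≤ 1 / 2) (ha : 0 < a) (hx0 : x < 0) (hlow : (a - 1) * lam ≤ x)
    (hup : 1 < lam * (1 + a) * (-x)) : rosenD lam a x = 1 := by
  have hlx : 0 < lam * (-x) := mul_pos hl (neg_pos.mpr hx0)
  have habs : |1 / (lam * x)| = 1 / (lam * (-x)) := by
    rw [abs_of_neg (by apply div_neg_of_pos_of_neg one_pos; nlinarith), mul_neg, div_neg]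
  have hprod : a * (lam * (-x)) ≤ 1 := by
    have h1 : lam * (-x) ≤ lam * ((1 - a) * lam) := by
      apply mul_le_mul_of_nonneg_left _ hl.le
      linarith
    have h2 : lam ^ 2 ≤ 4 := by nlinarith
    have h3 : a * (1 - a) ≤ 1 / 4 := by nlinarith [sq_nonneg (a - 1 / 2)]
    have h4 : 0 ≤ a * (1 - a) := mul_nonneg ha.le (by linarith)
    nlinarith [mul_le_mul_of_nonneg_left h1 ha.le, mul_le_mul_of_nonneg_left h2 h4]
  unfold rosenD
  rw [habs, Int.floor_eq_iff]
  have hge : a ≤ 1 / (lam * (-x)) := by rwa [le_div_iff₀ hlx]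
  have hlt : 1 / (lam * (-x)) < 1 + a := by
    rw [div_lt_iff₀ hlx]
    linarith
  push_cast
  constructor <;> linarith

/-- Points of `[(a - 1) lam, -(a lam)]` stay below the orbit of `-(a lam)`, written as ratios of
consecutive terms of the linear recurrence `u (j + 2) = lam u (j + 1) - u j`, as long as that
orbit has digits `1`. -/
theorem rosenT_iterate_bounds {lam a : ℝ} (hl : 0 < lam) (hl2 : lam < 2)
    (ha : 0 < a) (ha1 : a ≤ 1 / 2) {u : ℕ → ℝ} {n : ℕ} (hu0 : u 0 = 1) (hu1 : u 1 = a * lam)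
    (hrec : ∀ j, u (j + 2) = lam * u (j + 1) - u j)
    (hpos : ∀ j ≤ n + 1, 0 < u j) (hdig : ∀ j ≤ n, 0 < u (j + 2) + a * lam * u (j + 1))
    {x : ℝ} (hx : (a - 1) * lam ≤ x) (hx' : x ≤ -(a * lam)) :
    ∀ j ≤ n, (rosenT lam a)^[j] x < 0 ∧ rosenD lam a ((rosenT lam a)^[j] x) = 1 := by
  have digit : ∀ j ≤ n, ∀ y, (a - 1) * lam ≤ y → u (j + 1) ≤ -y * u j →
      y < 0 ∧ rosenD lam a y = 1 := by
    intro j hj y hy hyu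
    have p0 := hpos j (by omega)
    have p1 := hpos (j + 1) (by omega)
    have hy0 : y < 0 := by
      by_contra! h
      nlinarith
    refine ⟨hy0, rosenD_eq_one hl hl2 ha1 ha hy0 hy ?_⟩
    have h := hdig j hj
    rw [hrec] at h
    have hc : 0 < lam * (1 + a) := by positivity
    have h2 := mul_le_mul_of_nonneg_left hyu hc.le
    by_contra! hcon
    nlinarith
  have bounds : ∀ j ≤ n, (a - 1) * lam ≤ (rosenT lam a)^[j] x ∧
      u (j + 1) ≤ -((rosenT lam a)^[j] x) * u j := by
    intro j
    induction j with
    | zero =>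
      intro _
      simp only [Function.iterate_zero, id_eq, zero_add, hu0, hu1]
      exact ⟨hx, by linarith⟩
    | succ j ih =>
      intro hj
      obtain ⟨h1, h2⟩ := ih (by omega)
      rw [Function.iterate_succ_apply']
      generalize (rosenT lam a)^[j] x = y at h1 h2 ⊢
      obtain ⟨hy0, hd⟩ := digit j (by omega) y h1 h2
      have hy : 0 < -y := neg_pos.mpr hy0
      have hT : rosenT lam a y = 1 / (-y) - lam := by
        rw [rosenT, if_neg hy0.ne, hd, abs_of_neg (div_neg_of_pos_of_neg one_pos hy0), div_neg]
        simp
      rw [hT]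
      constructor
      · have hinv : 2 + y ≤ 1 / (-y) := by
          rw [le_div_iff₀ hy]
          nlinarith [sq_nonneg (y + 1)]
        linarith
      · have p1 := hpos (j + 1) (by omega)
        have hq : 1 / (-y) * u (j + 1) ≤ u j := by
          rw [one_div, inv_mul_le_iff₀ hy]
          exact h2
        rw [hrec]
        linarith
  intro j hj
  exact digit j hj _ (bounds j hj).1 (bounds j hj).2

/-- An `a` above the positive root of `l a² + (4 - l) a - 1`. -/
theorem pos_and_quadratic_pos_of_root_lt {l a : ℝ} (hl : 0 < l)
    (h : (l - 4 + √((4 - l) ^ 2 + 4 * l)) / (2 * l) < a) :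
    0 < a ∧ 0 < l * a ^ 2 + (4 - l) * a - 1 := by
  rw [div_lt_iff₀ (by positivity)] at h
  have hs : √((4 - l) ^ 2 + 4 * l) ^ 2 = (4 - l) ^ 2 + 4 * l := Real.sq_sqrt (by positivity)
  have hs0 := Real.sqrt_nonneg ((4 - l) ^ 2 + 4 * l)
  have hs1 : |4 - l| < √((4 - l) ^ 2 + 4 * l) := by
    rw [← Real.sqrt_sq_eq_abs]
    exact Real.sqrt_lt_sqrt (sq_nonneg _) (by linarith)
  generalize √((4 - l) ^ 2 + 4 * l) = s at *
  have hle := le_abs_self (4 - l)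
  have hapos : 0 < a := by
    by_contra! hcon
    nlinarith
  refine ⟨hapos, ?_⟩
  have hlt : s < a * (2 * l) + (4 - l) := by linarith
  have hsq : s ^ 2 < (a * (2 * l) + (4 - l)) ^ 2 := pow_lt_pow_left₀ hlt hs0 (by norm_num)
  by_contra! hcon
  nlinarith [mul_nonneg hl.le (sub_nonneg.mpr hcon)]

/-- for even `q = 2p`, `α ∈ (α₀, 1/2]`, the `T_α`-expansions of both `l₀` and
`−r₀` begin with `p−1` digits `(−1 : 1)`. -/
theorem stmt2 (p q : ℕ) (hp : 2 ≤ p) (hq : q = 2 * p)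
    (lam : ℝ) (hlam : lam = 2 * Real.cos (Real.pi / (q : ℝ)))
    (a : ℝ)
    (ha0 : (lam ^ 2 - 4 + Real.sqrt ((4 - lam ^ 2) ^ 2 + 4 * lam ^ 2)) / (2 * lam ^ 2) < a)
    (ha1 : a ≤ 1 / 2) :
    ∀ j : ℕ, j ≤ p - 2 →
      ((rosenT lam a)^[j] ((a - 1) * lam) < 0 ∧
        rosenD lam a ((rosenT lam a)^[j] ((a - 1) * lam)) = 1) ∧
      ((rosenT lam a)^[j] (-(a * lam)) < 0 ∧
        rosenD lam a ((rosenT lam a)^[j] (-(a * lam))) = 1) := by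
  obtain ⟨n, rfl⟩ : ∃ n, p = n + 2 := ⟨p - 2, by omega⟩
  have hn : (0 : ℝ) ≤ n := Nat.cast_nonneg n
  set θ : ℝ := Real.pi / (q : ℝ) with hθ
  have hqr : (q : ℝ) = 2 * (n + 2) := by rw [hq]; push_cast; ring
  have hθ0 : 0 < θ := by
    rw [hθ, hqr]
    positivity
  have hpθ : ((n : ℝ) + 2) * θ = π / 2 := by
    rw [hθ, hqr]
    field_simp
  have hθ2 : θ < π / 2 := by nlinarith
  have hc : 0 < cos θ := Real.cos_pos_of_mem_Ioo ⟨by linarith, hθ2⟩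
  have hs : 0 < sin θ := Real.sin_pos_of_pos_of_lt_pi hθ0 (by linarith)
  have hsc := Real.sin_sq_add_cos_sq θ
  have hl : 0 < lam := by linarith
  have hl2 : lam < 2 := by nlinarith
  obtain ⟨ha, hquad⟩ := pos_and_quadratic_pos_of_root_lt (by positivity) ha0
  set B : ℝ := (2 * a - 1) * cos θ / sin θ with hB
  have hBs : B * sin θ = (2 * a - 1) * cos θ := by
    rw [hB]
    field_simp
  have hB0 : B ≤ 0 := by
    apply div_nonpos_of_nonpos_of_nonneg _ hs.le
    nlinarith
  set u : ℕ → ℝ := fun j => cos (j * θ) + B * sin (j * θ) with hu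
  have hrec : ∀ j, u (j + 2) = lam * u (j + 1) - u j := by
    intro j
    have e2 : ((j + 2 : ℕ) : ℝ) * θ = (j + 1) * θ + θ := by push_cast; ring
    have e0 : (j : ℝ) * θ = (j + 1) * θ - θ := by ring
    have e1 : ((j + 1 : ℕ) : ℝ) * θ = (j + 1) * θ := by push_cast; ring
    simp only [hu]
    rw [e2, e1, e0, Real.cos_add, Real.cos_sub, Real.sin_add, Real.sin_sub, hlam]
    ring
  have hanti : ∀ i j : ℕ, i ≤ j → j ≤ n + 2 → u j ≤ u i := by
    intro i j hij hj
    have hij' : (i : ℝ) * θ ≤ j * θ := by gcongr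
    have hj' : (j : ℝ) * θ ≤ π / 2 := by
      rw [← hpθ]
      gcongr
      exact_mod_cast hj
    have hi' : 0 ≤ (i : ℝ) * θ := by positivity
    have h1 : cos (j * θ) ≤ cos (i * θ) :=
      Real.cos_le_cos_of_nonneg_of_le_pi hi' (by linarith [Real.pi_pos]) hij'
    have h2 : sin (i * θ) ≤ sin (j * θ) :=
      Real.sin_le_sin_of_le_of_le_pi_div_two (by linarith [Real.pi_pos]) hj' hij'
    simp only [hu]
    nlinarith
  have hup : u (n + 2) = B := by
    have e : ((n + 2 : ℕ) : ℝ) * θ = π / 2 := by rw [← hpθ]; push_cast; ring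
    simp only [hu]
    rw [e, Real.cos_pi_div_two, Real.sin_pi_div_two]
    ring
  have hup1 : u (n + 1) = sin θ + B * cos θ := by
    have e : ((n + 1 : ℕ) : ℝ) * θ = π / 2 - θ := by rw [← hpθ]; push_cast; ring
    simp only [hu]
    rw [e, Real.cos_pi_div_two_sub, Real.sin_pi_div_two_sub]
  have hkey : 0 < u (n + 2) + a * lam * u (n + 1) := by
    rw [hup, hup1]
    refine pos_of_mul_pos_left (b := sin θ) ?_ hs.le
    have e : (B + a * lam * (sin θ + B * cos θ)) * sin θ =
        cos θ * (lam ^ 2 * a ^ 2 + (4 - lam ^ 2) * a - 1) := by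
      calc (B + a * lam * (sin θ + B * cos θ)) * sin θ
          = B * sin θ + a * lam * (sin θ ^ 2 + (B * sin θ) * cos θ) := by ring
        _ = _ := by
          rw [hBs, hlam, eq_sub_of_add_eq hsc]
          ring
    rw [e]
    exact mul_pos hc hquad
  have hal : 0 < a * lam := mul_pos ha hl
  have hlast : 0 < u (n + 1) := by
    by_contra! hcon
    nlinarith
  have hbounds := fun {x : ℝ} => rosenT_iterate_bounds (x := x) (u := u) (n := n) hl hl2 ha ha1
    (by simp [hu])
    (by
      simp only [hu, Nat.cast_one, one_mul]
      rw [hBs, hlam]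
      ring)
    hrec
    (fun j hj => hlast.trans_le (hanti j (n + 1) hj (by omega)))
    (fun j hj => hkey.trans_le (add_le_add (hanti (j + 2) (n + 2) (by omega) le_rfl)
      (mul_le_mul_of_nonneg_left (hanti (j + 1) (n + 1) (by omega) (by omega)) hal.le)))
  have hends : (a - 1) * lam ≤ -(a * lam) := by nlinarith
  intro j hj
  exact ⟨hbounds le_rfl hends j (by omega), hbounds hends le_rfl j (by omega)⟩
end

section
/- Let q = 2p with p ≥ 2 be an even integer, λ = 2cos(π/q), and let α ∈ (α₀, 1/2]. Then T_α^{p−1}((α−1)λ) = (1−2α)λ/(αλ² − 2) and T_α^{p−1}(αλ) = (2α−1)λ/((1−α)λ² − 2). -/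
open Real MeasureTheory Set

/-- If subtracting `lam` once from `|1/x|` lands in the fundamental interval, the digit is `1`. -/
theorem rosenT_eq_of_mem {lam a x : ℝ} (hlam : 0 < lam) (hx : x ≠ 0)
    (hl : (a - 1) * lam ≤ |1 / x| - lam) (hr : |1 / x| - lam < a * lam) :
    rosenT lam a x = |1 / x| - lam := by
  have hd : rosenD lam a x = 1 := by
    have e : |1 / (lam * x)| = |1 / x| / lam := by
      rw [one_div, mul_inv, abs_mul, abs_of_pos (inv_pos.2 hlam), one_div, div_eq_inv_mul]
    rw [rosenD, Int.floor_eq_iff, e]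
    have h1 : a ≤ |1 / x| / lam := by
      rw [le_div_iff₀ hlam]; linarith
    have h2 : |1 / x| / lam < 1 + a := by
      rw [div_lt_iff₀ hlam]; linarith
    push_cast
    constructor <;> linarith
  rw [rosenT, if_neg hx, hd]
  simp

/-- Along a positive solution of `w (n + 2) = lam * w (n + 1) - w n`, the orbit of `-w 1 / w 0`
is given by the negated successive quotients. -/
theorem iterate_rosenT_neg_div {lam a : ℝ} (hlam : 0 < lam) (hlam2 : lam < 2) (ha : 0 < a)
    {w : ℕ → ℝ} (hw : ∀ n, w (n + 2) = lam * w (n + 1) - w n)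
    (h0 : (a - 1) * lam ≤ -w 1 / w 0) (m : ℕ) (hpos : ∀ n ≤ m, 0 < w n)
    (hm : -w (m + 1) / w m < a * lam) :
    (rosenT lam a)^[m] (-w 1 / w 0) = -w (m + 1) / w m ∧
      (a - 1) * lam ≤ -w (m + 1) / w m := by
  induction m with
  | zero => exact ⟨rfl, h0⟩
  | succ m ih =>
    have p0 : 0 < w m := hpos m (by omega)
    have p1 : 0 < w (m + 1) := hpos (m + 1) le_rfl
    have hneg : -w (m + 1) / w m < 0 := div_neg_of_neg_of_pos (by linarith) p0
    obtain ⟨ih1, ih2⟩ := ih (fun n hn => hpos n (by omega)) (hneg.trans (by positivity))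
    have hstep : |1 / (-w (m + 1) / w m)| - lam = -w (m + 1 + 1) / w (m + 1) := by
      rw [abs_of_neg (one_div_neg.2 hneg), show m + 1 + 1 = m + 2 from rfl, hw]
      field_simp
      ring
    have hincr : -w (m + 1) / w m ≤ -w (m + 1 + 1) / w (m + 1) := by
      rw [show m + 1 + 1 = m + 2 from rfl, hw, div_le_div_iff₀ p0 p1]
      nlinarith [sq_nonneg (w m - w (m + 1)), mul_pos p0 p1]
    refine ⟨?_, ih2.trans hincr⟩
    rw [Function.iterate_succ_apply', ih1, ← hstep]
    exact rosenT_eq_of_mem hlam hneg.ne (hstep ▸ ih2.trans hincr) (hstep ▸ hm)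

/-- The solution of `w (n + 2) = 2 cos t * w (n + 1) - w n` with `w 0 = sin t` and
`w 1 = (1 + c) cos t sin t`. -/
noncomputable def rosenSeq (t c : ℝ) (n : ℕ) : ℝ :=
  cos (n * t) * sin t + c * cos t * sin (n * t)

theorem rosenSeq_add_two (t c : ℝ) (n : ℕ) :
    rosenSeq t c (n + 2) = 2 * cos t * rosenSeq t c (n + 1) - rosenSeq t c n := by
  have e1 : ((n + 2 : ℕ) : ℝ) * t = ((n : ℝ) * t + t) + t := by push_cast; ring
  have e2 : ((n + 1 : ℕ) : ℝ) * t = (n : ℝ) * t + t := by push_cast; ring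
  simp only [rosenSeq, e1, e2, cos_add, sin_add]
  linear_combination (-(cos (n * t) * sin t + c * cos t * sin (n * t))) * sin_sq_add_cos_sq t

theorem rosenSeq_zero (t c : ℝ) : rosenSeq t c 0 = sin t := by simp [rosenSeq]

theorem rosenSeq_one (t c : ℝ) : rosenSeq t c 1 = (1 + c) * cos t * sin t := by
  simp [rosenSeq]; ring

theorem rosenSeq_of_mul_eq_pi_div_two {t : ℝ} (c : ℝ) {n : ℕ} (h : (n : ℝ) * t = π / 2) :
    rosenSeq t c n = c * cos t := by
  simp [rosenSeq, h]

theorem rosenSeq_of_succ_mul_eq_pi_div_two {t : ℝ} (c : ℝ) {n : ℕ}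
    (h : ((n + 1 : ℕ) : ℝ) * t = π / 2) :
    rosenSeq t c n = 1 - (1 - c) * cos t ^ 2 := by
  have : (n : ℝ) * t = π / 2 - t := by push_cast at h; linarith
  rw [rosenSeq, this, cos_pi_div_two_sub, sin_pi_div_two_sub]
  linear_combination sin_sq_add_cos_sq t

theorem rosenSeq_pos_of_nonneg {t c : ℝ} (ht : 0 < t) (hc : 0 ≤ c) {n : ℕ}
    (h : ((n + 1 : ℕ) : ℝ) * t ≤ π / 2) : 0 < rosenSeq t c n := by
  push_cast at h
  have hn : 0 ≤ (n : ℝ) * t := by positivity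
  have h1 : 0 < cos (n * t) := cos_pos_of_mem_Ioo ⟨by linarith [pi_pos], by linarith⟩
  have h2 : 0 < sin t := sin_pos_of_pos_of_lt_pi ht (by linarith [pi_pos])
  have h3 : 0 ≤ cos t := cos_nonneg_of_mem_Icc ⟨by linarith [pi_pos], by linarith⟩
  have h4 : 0 ≤ sin (n * t) := sin_nonneg_of_nonneg_of_le_pi hn (by linarith [pi_pos])
  unfold rosenSeq
  positivity

theorem rosenSeq_le_of_nonpos {t c : ℝ} (ht : 0 < t) (hc : c ≤ 0) {m n : ℕ} (hmn : m ≤ n)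
    (h : ((n + 1 : ℕ) : ℝ) * t ≤ π / 2) : rosenSeq t c n ≤ rosenSeq t c m := by
  push_cast at h
  have hm : 0 ≤ (m : ℝ) * t := by positivity
  have hle : (m : ℝ) * t ≤ n * t := by gcongr
  have h1 : cos (n * t) ≤ cos (m * t) :=
    cos_le_cos_of_nonneg_of_le_pi hm (by linarith [pi_pos]) hle
  have h2 : 0 < sin t := sin_pos_of_pos_of_lt_pi ht (by linarith [pi_pos])
  have h3 : 0 ≤ cos t := cos_nonneg_of_mem_Icc ⟨by linarith [pi_pos], by linarith⟩
  have h4 : sin (m * t) ≤ sin (n * t) :=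
    sin_le_sin_of_le_of_le_pi_div_two (by linarith [pi_pos]) (by linarith) hle
  have h5 := mul_le_mul_of_nonneg_right h1 h2.le
  have h6 := mul_le_mul_of_nonpos_left h4 (mul_nonpos_of_nonpos_of_nonneg hc h3)
  unfold rosenSeq
  linarith

/-- The lower bound on `a` says that `a` exceeds the larger root of a quadratic. -/
theorem pos_and_quadratic_of_root_lt {C a : ℝ} (hC : 0 < C)
    (h : (C - 4 + √((4 - C) ^ 2 + 4 * C)) / (2 * C) < a) :
    0 < a ∧ 1 < C * a ^ 2 + (4 - C) * a := by
  rw [div_lt_iff₀ (by positivity)] at h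
  have hs : √((4 - C) ^ 2 + 4 * C) < 2 * C * a + (4 - C) := by linarith
  have h1 : 4 - C < √((4 - C) ^ 2 + 4 * C) := lt_sqrt_of_sq_lt (by linarith)
  refine ⟨pos_of_mul_pos_right (b := a) (a := 2 * C) (by linarith) (by positivity), ?_⟩
  rw [sqrt_lt' ((sqrt_nonneg _).trans_lt hs)] at hs
  nlinarith

/-- for even `q = 2p`, `α ∈ (α₀, 1/2]`,
`T_α^{p−1}((α−1)λ) = (1−2α)λ/(αλ² − 2)` and `T_α^{p−1}(αλ) = (2α−1)λ/((1−α)λ² − 2)`. -/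
theorem stmt3 (p q : ℕ) (hp : 2 ≤ p) (hq : q = 2 * p)
    (lam : ℝ) (hlam : lam = 2 * Real.cos (Real.pi / (q : ℝ)))
    (a : ℝ)
    (ha0 : (lam ^ 2 - 4 + Real.sqrt ((4 - lam ^ 2) ^ 2 + 4 * lam ^ 2)) / (2 * lam ^ 2) < a)
    (ha1 : a ≤ 1 / 2) :
    (rosenT lam a)^[p - 1] ((a - 1) * lam) = (1 - 2 * a) * lam / (a * lam ^ 2 - 2) ∧
    (rosenT lam a)^[p - 1] (a * lam) = (2 * a - 1) * lam / ((1 - a) * lam ^ 2 - 2) := by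
  obtain ⟨k, rfl⟩ : ∃ k, p = k + 2 := ⟨p - 2, by omega⟩
  set t := π / (q : ℝ) with ht_def
  have hk : ((k + 2 : ℕ) : ℝ) * t = π / 2 := by
    rw [ht_def, hq]
    push_cast
    field_simp
  have ht : 0 < t := by
    rw [ht_def, hq]
    have := pi_pos
    positivity
  have ht4 : t ≤ π / 4 := by
    push_cast at hk
    nlinarith [(Nat.cast_nonneg k : (0 : ℝ) ≤ k)]
  have hsin : 0 < sin t := sin_pos_of_pos_of_lt_pi ht (by linarith [pi_pos])
  have hcos : 0 < cos t := cos_pos_of_mem_Ioo ⟨by linarith [pi_pos], by linarith [pi_pos]⟩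
  have hcos1 : cos t < 1 := by nlinarith [sin_sq_add_cos_sq t]
  have hcos2 : 1 ≤ 2 * cos t ^ 2 := by
    have h : 0 ≤ cos (2 * t) := cos_nonneg_of_mem_Icc ⟨by linarith [pi_pos], by linarith⟩
    rw [cos_two_mul] at h
    linarith
  have hpos : 0 < lam := by linarith
  have hlt2 : lam < 2 := by linarith
  have hsq : lam ^ 2 = 4 * cos t ^ 2 := by rw [hlam]; ring
  obtain ⟨ha, hquad⟩ := pos_and_quadratic_of_root_lt (by positivity) ha0
  have hrec : ∀ c n, rosenSeq t c (n + 2) = lam * rosenSeq t c (n + 1) - rosenSeq t c n := by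
    intro c n
    rw [hlam, rosenSeq_add_two]
  have hbound : ∀ n ≤ k + 1, ((n + 1 : ℕ) : ℝ) * t ≤ π / 2 := by
    intro n hn
    rw [← hk]
    exact mul_le_mul_of_nonneg_right (Nat.cast_le.2 (by omega)) ht.le
  have hden : 0 < 2 - (1 - a) * lam ^ 2 := by nlinarith
  have hden' : 0 < 2 - a * lam ^ 2 := by nlinarith
  have hquot : ∀ c, -rosenSeq t c (k + 2) / rosenSeq t c (k + 1) =
      -(c * cos t) / (1 - (1 - c) * cos t ^ 2) := by
    intro c
    rw [rosenSeq_of_mul_eq_pi_div_two c hk, rosenSeq_of_succ_mul_eq_pi_div_two c hk]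
  rw [show k + 2 - 1 = k + 1 from rfl]
  constructor
  · have hq1 : -rosenSeq t (1 - 2 * a) (k + 2) / rosenSeq t (1 - 2 * a) (k + 1) =
        (1 - 2 * a) * lam / (a * lam ^ 2 - 2) := by
      have h1 : a * lam ^ 2 - 2 ≠ 0 := by linarith
      have h2 : 1 - (1 - (1 - 2 * a)) * cos t ^ 2 ≠ 0 := by nlinarith
      rw [hquot, div_eq_div_iff h2 h1, hlam]
      ring
    have hstart : -rosenSeq t (1 - 2 * a) 1 / rosenSeq t (1 - 2 * a) 0 = (a - 1) * lam := by
      rw [rosenSeq_zero, rosenSeq_one, hlam]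
      field_simp
      ring
    have hend : (1 - 2 * a) * lam / (a * lam ^ 2 - 2) < a * lam :=
      (div_nonpos_of_nonneg_of_nonpos (mul_nonneg (by linarith) hpos.le)
        (by linarith)).trans_lt (by positivity)
    have h := (iterate_rosenT_neg_div hpos hlt2 ha (hrec _) hstart.ge (k + 1)
      (fun n hn => rosenSeq_pos_of_nonneg ht (by linarith) (hbound n hn)) (hq1 ▸ hend)).1
    rwa [hstart, hq1] at h
  · have hq1 : -rosenSeq t (2 * a - 1) (k + 2) / rosenSeq t (2 * a - 1) (k + 1) =
        (2 * a - 1) * lam / ((1 - a) * lam ^ 2 - 2) := by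
      have h1 : (1 - a) * lam ^ 2 - 2 ≠ 0 := by linarith
      have h2 : 1 - (1 - (2 * a - 1)) * cos t ^ 2 ≠ 0 := by nlinarith
      rw [hquot, div_eq_div_iff h2 h1, hlam]
      ring
    have hseq_pos : ∀ n ≤ k + 1, 0 < rosenSeq t (2 * a - 1) n := by
      intro n hn
      refine lt_of_lt_of_le ?_ (rosenSeq_le_of_nonpos ht (by linarith) hn (hbound _ le_rfl))
      rw [rosenSeq_of_succ_mul_eq_pi_div_two _ hk]
      nlinarith
    have hend : (2 * a - 1) * lam / ((1 - a) * lam ^ 2 - 2) < a * lam := by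
      rw [← neg_div_neg_eq, div_lt_iff₀ (by linarith)]
      nlinarith
    have hfirst : |1 / (a * lam)| - lam =
        -rosenSeq t (2 * a - 1) 2 / rosenSeq t (2 * a - 1) 1 := by
      rw [abs_of_pos (by positivity), hrec, rosenSeq_zero, rosenSeq_one, hlam]
      field_simp
      ring
    have hlow : (a - 1) * lam ≤ |1 / (a * lam)| - lam := by
      rw [abs_of_pos (by positivity)]
      have h1 : a * lam ≤ 1 := by nlinarith
      have h2 : 1 ≤ 1 / (a * lam) := by rwa [one_le_div (by positivity)]
      linarith
    have hhigh : |1 / (a * lam)| - lam < a * lam := by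
      rw [abs_of_pos (by positivity), sub_lt_iff_lt_add, div_lt_iff₀ (by positivity)]
      nlinarith
    rw [Function.iterate_succ_apply,
      rosenT_eq_of_mem hpos (by positivity) hlow hhigh, hfirst]
    have h := (iterate_rosenT_neg_div hpos hlt2 ha
      (w := fun n => rosenSeq t (2 * a - 1) (n + 1)) (fun n => hrec _ (n + 1))
      (hfirst ▸ hlow) k (fun n hn => hseq_pos (n + 1) (by omega)) (hq1 ▸ hend)).1
    exact h.trans hq1
end

section
/- Let q = 2p with p ≥ 2 be an even integer, λ = 2cos(π/q), and let α₀ = (λ² − 4 + √((4 − λ²)² + 4λ²))/(2λ²). Then T_{α₀}^{p−2}(−α₀λ) = −1/(λ(1 + α₀)); that is, at the parameter α = α₀ the (p−2)-nd T_{α₀}-image of −r_0 is exactly the cylinder endpoint −δ_1 = −1/(λ(1+α₀)). -/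
open Real MeasureTheory Set

/-- The positive solution `a = (λ² - 4 + √((4 - λ²)² + 4λ²)) / (2λ²)` of
`λ² a² + (4 - λ²) a = 1`. -/
theorem rosen_param_pos_and_quadratic {lam a : ℝ} (h0 : 0 < lam)
    (ha : a = (lam ^ 2 - 4 + √((4 - lam ^ 2) ^ 2 + 4 * lam ^ 2)) / (2 * lam ^ 2)) :
    0 < a ∧ lam ^ 2 * a ^ 2 + (4 - lam ^ 2) * a = 1 := by
  have hnn : 0 ≤ (4 - lam ^ 2) ^ 2 + 4 * lam ^ 2 := by positivity
  have hL : 0 < lam ^ 2 := by positivity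
  constructor
  · rw [ha]
    apply div_pos _ (by positivity)
    have : 4 - lam ^ 2 < √((4 - lam ^ 2) ^ 2 + 4 * lam ^ 2) :=
      Real.lt_sqrt_of_sq_lt (by linarith)
    linarith
  · have hr : √((4 - lam ^ 2) ^ 2 + 4 * lam ^ 2) = 2 * lam ^ 2 * a + 4 - lam ^ 2 := by
      rw [ha]
      field_simp
      ring
    have hsq := Real.sq_sqrt hnn
    rw [hr] at hsq
    have : lam ^ 2 * (lam ^ 2 * a ^ 2 + (4 - lam ^ 2) * a) = lam ^ 2 * 1 := by
      linear_combination hsq / 4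
    exact mul_left_cancel₀ hL.ne' this

/-- On the negative part of the cylinder of digit `1` the map `T_α` is `x ↦ -1/x - λ`. -/
theorem rosenT_neg_of_digit_one {lam a t : ℝ} (hl : 0 < lam) (ht : 0 < t)
    (h1 : lam * a * t ≤ 1) (h2 : 1 < lam * (1 + a) * t) :
    rosenT lam a (-t) = -(lam - 1 / t) := by
  have habs : |1 / (lam * -t)| = 1 / (lam * t) := by
    rw [abs_div, abs_one, mul_neg, abs_neg, abs_of_pos (by positivity)]
  have hd : rosenD lam a (-t) = 1 := by
    have e1 : a ≤ 1 / (lam * t) := by rw [le_div_iff₀ (by positivity)]; linarith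
    have e2 : 1 / (lam * t) < 1 + a := by rw [div_lt_iff₀ (by positivity)]; linarith
    rw [rosenD, habs, Int.floor_eq_iff]
    push_cast
    constructor <;> linarith
  rw [rosenT, if_neg (neg_ne_zero.mpr ht.ne'), hd, abs_div, abs_one, abs_neg, abs_of_pos ht]
  push_cast
  ring

/-- The solution of `V (k + 2) = 2 cos θ * V (k + 1) - V k` whose ratio `V 1 / V 0` is `b`. -/
noncomputable def sinRec (θ b : ℝ) (k : ℕ) : ℝ := b * sin (k * θ) - sin ((k - 1) * θ)

theorem sinRec_zero (θ b : ℝ) : sinRec θ b 0 = sin θ := by simp [sinRec]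

theorem sinRec_one (θ b : ℝ) : sinRec θ b 1 = b * sin θ := by simp [sinRec]

theorem sinRec_add_two (θ b : ℝ) (k : ℕ) :
    sinRec θ b (k + 2) = 2 * cos θ * sinRec θ b (k + 1) - sinRec θ b k := by
  have h (x : ℝ) : sin (x + θ) = 2 * cos θ * sin x - sin (x - θ) := by
    rw [sin_add, sin_sub]; ring
  have h1 := h ((k + 1) * θ)
  have h2 := h (k * θ)
  simp only [sinRec]
  push_cast
  rw [show ((k : ℝ) + 2) * θ = (k + 1) * θ + θ by ring,
    show ((k : ℝ) + 2 - 1) * θ = k * θ + θ by ring, h1, h2,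
    show ((k : ℝ) + 1) * θ - θ = k * θ by ring, show (k : ℝ) * θ - θ = (k - 1) * θ by ring,
    show ((k : ℝ) + 1 - 1) * θ = k * θ by ring]
  ring

theorem sinRec_pos {θ b : ℝ} (hθ : 0 < θ) (hb : cos (2 * θ) < b * cos θ) {k : ℕ}
    (hk : (k + 1) * θ ≤ π / 2) : 0 < sinRec θ b k := by
  have hk0 : (0 : ℝ) ≤ k * θ := by positivity
  have hs : 0 < sin θ := sin_pos_of_pos_of_lt_pi hθ (by linarith [pi_pos])
  rcases Nat.eq_zero_or_pos k with rfl | hpos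
  · rwa [sinRec_zero]
  have hkθ : 0 < (k : ℝ) * θ := by positivity
  have hc : 0 < cos θ := cos_pos_of_mem_Ioo ⟨by linarith [pi_pos], by linarith⟩
  have hsk : 0 < sin (k * θ) := sin_pos_of_pos_of_lt_pi hkθ (by linarith [pi_pos])
  have hck : 0 ≤ cos (k * θ + θ) :=
    cos_nonneg_of_mem_Icc ⟨by linarith [pi_pos], by linarith⟩
  have hm := mul_lt_mul_of_pos_right hb hsk
  have hid : cos θ * sinRec θ b k
      = (b * cos θ - cos (2 * θ)) * sin (k * θ) + sin θ * cos (k * θ + θ) := by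
    rw [sinRec, show ((k : ℝ) - 1) * θ = k * θ - θ by ring, sin_sub, cos_add, cos_two_mul]
    linear_combination sin (k * θ) * sin_sq_add_cos_sq θ
  have : 0 < cos θ * sinRec θ b k := by
    rw [hid]
    have := mul_nonneg hs.le hck
    linarith
  exact pos_of_mul_pos_right this hc.le

/-- Consecutive ratios of `sinRec` decrease strictly as long as its values are positive. -/
theorem sinRec_ratio_succ_lt {θ b : ℝ} (hc : cos θ < 1) {k : ℕ}
    (h0 : 0 < sinRec θ b k) (h1 : 0 < sinRec θ b (k + 1)) :
    sinRec θ b (k + 2) / sinRec θ b (k + 1) < sinRec θ b (k + 1) / sinRec θ b k := by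
  rw [div_lt_div_iff₀ h1 h0, sinRec_add_two]
  nlinarith [sq_nonneg (sinRec θ b (k + 1) - sinRec θ b k),
    mul_pos (mul_pos h0 h1) (sub_pos.mpr hc)]

/-- for even `q = 2p`, at the parameter `α = α₀` one has
`T_{α₀}^{p−2}(−α₀λ) = −δ₁ = −1/(λ(1 + α₀))`. -/
theorem stmt6 (p q : ℕ) (hp : 2 ≤ p) (hq : q = 2 * p)
    (lam : ℝ) (hlam : lam = 2 * Real.cos (Real.pi / (q : ℝ)))
    (a0 : ℝ)
    (ha0 : a0 = (lam ^ 2 - 4 + Real.sqrt ((4 - lam ^ 2) ^ 2 + 4 * lam ^ 2)) / (2 * lam ^ 2)) :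
    (rosenT lam a0)^[p - 2] (-(a0 * lam)) = -(1 / (lam * (1 + a0))) := by
  have hp' : (2 : ℝ) ≤ p := by exact_mod_cast hp
  set θ := π / (q : ℝ) with hθdef
  have hpθ : (p : ℝ) * θ = π / 2 := by
    rw [hθdef, hq]; push_cast; field_simp
  have hθ : 0 < θ := by rw [hθdef, hq]; push_cast; positivity
  have h2θ : 2 * θ ≤ π / 2 := by nlinarith
  have hs : 0 < sin θ := sin_pos_of_pos_of_lt_pi hθ (by linarith)
  have hc0 : 0 < cos θ := cos_pos_of_mem_Ioo ⟨by linarith, by linarith⟩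
  have hc1 : cos θ < 1 := by nlinarith [sin_sq_add_cos_sq θ]
  have hl : 0 < lam := by linarith
  have hl4 : lam ^ 2 < 4 := by nlinarith
  obtain ⟨ha, hquad⟩ := rosen_param_pos_and_quadratic hl ha0
  have hb : cos (2 * θ) < a0 * lam * cos θ := by
    have hcl : cos θ = lam / 2 := by linarith
    rw [cos_two_mul, hcl]
    by_contra! hcon
    have hu : a0 * lam ^ 2 ≤ lam ^ 2 - 2 := by nlinarith
    have hm : (lam ^ 2) * (lam ^ 2 * a0 ^ 2 + (4 - lam ^ 2) * a0) = lam ^ 2 := by rw [hquad, mul_one]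
    nlinarith [mul_nonneg (mul_pos ha (pow_pos hl 2)).le (sub_nonneg.mpr hu)]
  set V := sinRec θ (a0 * lam) with hV
  obtain ⟨n, rfl⟩ : ∃ n, p = n + 2 := ⟨p - 2, by omega⟩
  push_cast at hpθ
  have hpos : ∀ k ≤ n + 1, 0 < V k := fun k hk => by
    refine sinRec_pos hθ hb ?_
    have : (k : ℝ) ≤ n + 1 := by exact_mod_cast hk
    nlinarith
  have hlast : V (n + 1) / V n = 1 / (lam * (1 + a0)) := by
    have h1 : V (n + 1) = a0 * lam * cos θ - cos (2 * θ) := by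
      rw [hV, sinRec, ← sin_pi_div_two_sub, ← sin_pi_div_two_sub, ← hpθ]
      push_cast
      ring_nf
    have h2 : V n = a0 * lam * cos (2 * θ) - cos (3 * θ) := by
      rw [hV, sinRec, ← sin_pi_div_two_sub, ← sin_pi_div_two_sub, ← hpθ]
      ring_nf
    have hcl : cos θ = lam / 2 := by linarith
    rw [div_eq_div_iff (hpos n (by omega)).ne' (by positivity), h1, h2, cos_three_mul,
      cos_two_mul, hcl]
    linear_combination (lam / 2) * hquad
  have hanti : StrictAntiOn (fun k => V (k + 1) / V k) (Set.Iic n) :=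
    strictAntiOn_Iic_of_succ_lt fun k hk => by
      exact sinRec_ratio_succ_lt hc1 (hpos k (by omega)) (hpos (k + 1) (by omega))
  have hfirst : V 1 / V 0 = a0 * lam := by
    rw [hV, sinRec_zero, sinRec_one, mul_div_cancel_right₀ _ hs.ne']
  have horbit : ∀ k ≤ n, (rosenT lam a0)^[k] (-(a0 * lam)) = -(V (k + 1) / V k) := by
    intro k
    induction k with
    | zero => simp [hfirst]
    | succ k ih =>
      intro hk
      have h0 := hpos k (by omega)
      have h1 := hpos (k + 1) (by omega)
      have hub : V (k + 1) / V k ≤ a0 * lam := by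
        rw [← hfirst]
        exact hanti.antitoneOn (Set.mem_Iic.mpr (Nat.zero_le n)) (Set.mem_Iic.mpr (by omega))
          (Nat.zero_le k)
      have hlb : 1 / (lam * (1 + a0)) < V (k + 1) / V k := by
        rw [← hlast]
        exact hanti (Set.mem_Iic.mpr (by omega)) (Set.mem_Iic.mpr le_rfl) (by omega)
      rw [Function.iterate_succ_apply', ih (by omega), rosenT_neg_of_digit_one hl (div_pos h1 h0)]
      · rw [hV, sinRec_add_two, ← hlam, ← hV]
        field_simp
      · have := mul_le_mul_of_nonneg_left hub (mul_pos hl ha).le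
        nlinarith [mul_pos (sub_pos.mpr hl4) ha]
      · rwa [div_lt_iff₀' (by positivity)] at hlb
  rw [Nat.add_sub_cancel, horbit n le_rfl, hlast]
end

section
/- Let q = 2h+3 with h ≥ 1 be an odd integer, λ = 2cos(π/q), and let α ∈ (α₀, 1/2]. Then for x₀ equal to either (α−1)λ or −αλ: for every j ∈ {0, …, h−1} ∪ {h+1, …, 2h} one has T_α^j(x₀) < 0 and d_α(T_α^j(x₀)) = 1, while T_α^h(x₀) < 0 and d_α(T_α^h(x₀)) = 2; that is, the T_α-expansions of both l_0 and −r_0 begin [(−1:1)^h, (−1:2), (−1:1)^h, …]. -/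
open Real MeasureTheory Set

/-- Criterion for a negative point to have digit `d`, together with its image. -/
lemma rosenD_neg_eq_and_rosenT_neg_eq {lam a t : ℝ} (d : ℤ) (hlam : 0 < lam) (ht : 0 < t)
    (hle : (d - 1 + a) * lam * t ≤ 1) (hlt : 1 < (d + a) * lam * t) :
    rosenD lam a (-t) = d ∧ rosenT lam a (-t) = -(d * lam - 1 / t) := by
  have hD : rosenD lam a (-t) = d := by
    have habs : |1 / (lam * -t)| = 1 / (lam * t) := by
      rw [mul_neg, div_neg, abs_neg, abs_of_pos (by positivity)]
    rw [rosenD, habs, Int.floor_eq_iff]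
    have h1 : d - 1 + a ≤ 1 / (lam * t) := by
      rw [le_div_iff₀ (by positivity)]; linarith
    have h2 : 1 / (lam * t) < d + a := by
      rw [div_lt_iff₀ (by positivity)]; linarith
    constructor <;> linarith
  refine ⟨hD, ?_⟩
  rw [rosenT, if_neg (by linarith), hD, div_neg, abs_neg, abs_of_pos (by positivity)]
  ring

/-- A block of `k` digits equal to `1`, for a Chebyshev-type sequence `s`: the `k`-th image
of `-t` is minus the Möbius transform of `t` given by consecutive terms of `s`. -/
lemma rosenD_eq_one_block {lam a : ℝ} {s : ℕ → ℝ} (hlam : 0 < lam) (ha : 0 < a)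
    (hal : a * (1 - a) * lam ^ 2 ≤ 1) (hs0 : s 0 = 0) (hs1 : 0 < s 1)
    (hs : ∀ k, s (k + 2) = lam * s (k + 1) - s k) (k : ℕ) :
    ∀ t : ℝ, (∀ i, 0 < i → i ≤ k → 0 < s i) → a * lam * t ≤ 1 →
      0 < s k * t - (lam * s k - s (k + 1)) →
      0 < s (k + 1) * t - s k + a * lam * (s k * t - (lam * s k - s (k + 1))) →
      (∀ j < k, (rosenT lam a)^[j] (-t) < 0 ∧ rosenD lam a ((rosenT lam a)^[j] (-t)) = 1) ∧
      (rosenT lam a)^[k] (-t) =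
        -((s (k + 1) * t - s k) / (s k * t - (lam * s k - s (k + 1)))) := by
  induction k with
  | zero =>
    intro t _ _ _ _
    refine ⟨fun j hj => absurd hj (Nat.not_lt_zero j), ?_⟩
    simp only [Function.iterate_zero, id, hs0, zero_add]
    rw [zero_mul, mul_zero, zero_sub, sub_zero, zero_sub, neg_neg, mul_div_cancel_left₀ _ hs1.ne']
  | succ k ih =>
    intro t hpos hle hden hnum
    have hk1 : 0 < s (k + 1) := hpos _ k.succ_pos le_rfl
    have hk0 : 0 ≤ s k := by
      rcases Nat.eq_zero_or_pos k with rfl | hk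
      · exact hs0.ge
      · exact (hpos k hk k.le_succ).le
    have hden' : 0 < s (k + 1) * t - s k := by
      have := hs k
      linarith
    have ht : 0 < t := by
      by_contra! hneg
      nlinarith [mul_nonneg hk1.le (neg_nonneg.2 hneg)]
    have hlt : 1 < (1 + a) * lam * t := by
      rcases Nat.eq_zero_or_pos k with rfl | hk
      · have h2 := hs 0
        simp only [zero_add, hs0, sub_zero] at h2 hnum
        rw [h2] at hnum
        have : 0 < s 1 * ((1 + a) * lam * t - 1) := by linarith
        linarith [pos_of_mul_pos_right this hs1.le]
      · obtain ⟨m, rfl⟩ : ∃ m, k = m + 1 := ⟨k - 1, by omega⟩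
        have hm0 : 0 ≤ s m := by
          rcases Nat.eq_zero_or_pos m with rfl | hm
          · exact hs0.ge
          · exact (hpos m hm (by omega)).le
        have hm1 : 0 < s (m + 1) := hpos _ m.succ_pos (by omega)
        have h2 := hs m
        have h3 : 0 < s (m + 1) * (lam * t - 1) := by
          rw [h2] at hden'
          nlinarith [mul_nonneg hm0 ht.le]
        have h4 := pos_of_mul_pos_right h3 hm1.le
        have h5 : 0 < a * (lam * t) := by positivity
        linarith
    obtain ⟨hD, hT⟩ := rosenD_neg_eq_and_rosenT_neg_eq (lam := lam) (a := a) (t := t) 1 hlam ht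
      (by push_cast; linarith) (by push_cast; linarith)
    have hT' : rosenT lam a (-t) = -(lam - 1 / t) := by rw [hT]; push_cast; ring
    have hinv : a * lam ≤ 1 / t := by rw [le_div_iff₀ ht]; exact hle
    have e1 : s k * (lam - 1 / t) - (lam * s k - s (k + 1)) = (s (k + 1) * t - s k) / t := by
      field_simp
      ring
    have e2 : s (k + 1) * (lam - 1 / t) - s k = (s (k + 2) * t - s (k + 1)) / t := by
      rw [hs k]
      field_simp
      ring
    have e3 : s (k + 1) * t - (lam * s (k + 1) - s (k + 2)) = s (k + 1) * t - s k := by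
      rw [hs k]; ring
    obtain ⟨ih1, ih2⟩ := ih (lam - 1 / t) (fun i hi hik => hpos i hi (hik.trans k.le_succ))
      (by nlinarith [mul_pos ha hlam]) (by rw [e1]; positivity) (by
        rw [e1, e2, ← mul_div_assoc, ← add_div]
        rw [e3] at hnum
        exact div_pos hnum ht)
    constructor
    · intro j hj
      cases j with
      | zero => exact ⟨by simpa using ht, by simpa using hD⟩
      | succ j =>
        rw [Function.iterate_succ_apply, hT']
        exact ih1 j (by omega)
    · rw [Function.iterate_succ_apply, hT', ih2, e1, e2, e3, div_div_div_cancel_right₀ ht.ne']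

/-- The defining inequality `α₀ < α` in polynomial form. -/
lemma pos_and_quadratic_of_rosen_bound_lt {lam a : ℝ} (h0 : 0 < lam)
    (ha : (lam - 2 + √(2 * lam ^ 2 - 4 * lam + 4)) / lam ^ 2 < a) :
    0 < a ∧ 1 < lam ^ 2 * a ^ 2 + 2 * (2 - lam) * a := by
  have hl2 : 0 < lam ^ 2 := by positivity
  rw [div_lt_iff₀ hl2] at ha
  have hsq : 2 - lam < √(2 * lam ^ 2 - 4 * lam + 4) := by
    apply Real.lt_sqrt_of_sq_lt
    nlinarith
  have hlt : 2 * lam ^ 2 - 4 * lam + 4 < (a * lam ^ 2 + 2 - lam) ^ 2 :=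
    Real.lt_sq_of_sqrt_lt (by linarith)
  constructor
  · have : 0 < a * lam ^ 2 := by linarith
    exact pos_of_mul_pos_left this hl2.le
  · have : 0 < lam ^ 2 * (lam ^ 2 * a ^ 2 + 2 * (2 - lam) * a - 1) := by nlinarith
    linarith [pos_of_mul_pos_right this hl2.le]

/-- Elementary bounds for `λ = 2cos(π/q)` with `q ≥ 5`. -/
lemma two_mul_cos_pi_div_bounds {q : ℕ} (hq : 5 ≤ q) :
    1 < 2 * cos (π / q) ∧ 2 * cos (π / q) < 2 ∧
      0 ≤ (2 * cos (π / q)) ^ 2 - 2 * cos (π / q) - 1 := by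
  have hqR : (5 : ℝ) ≤ q := by exact_mod_cast hq
  have hle : √5 + 1 ≤ 4 * cos (π / q) := by
    have h5 : cos (π / 5) ≤ cos (π / q) :=
      cos_le_cos_of_nonneg_of_le_pi (by positivity) (by linarith [pi_pos])
        (div_le_div_of_nonneg_left pi_pos.le (by norm_num) hqR)
    rw [cos_pi_div_five] at h5
    linarith
  have hlt : cos (π / q) < 1 := by
    rw [← cos_zero]
    exact cos_lt_cos_of_nonneg_of_le_pi le_rfl
      (div_le_self pi_pos.le (by linarith)) (by positivity)
  have h1 : 1 < √5 := Real.lt_sqrt_of_sq_lt (by norm_num)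
  have h5 : √5 ^ 2 = 5 := Real.sq_sqrt (by norm_num)
  refine ⟨by linarith, by linarith, ?_⟩
  nlinarith

/-- The first `h` digits of `-t` are `1` when `λ = 2cos(π/(2h+3))`, with the explicit `h`-th
image. -/
lemma rosenD_eq_one_block_of_odd {h q : ℕ} {lam a : ℝ} (hq : q = 2 * h + 3)
    (hlam : lam = 2 * cos (π / q)) (hl0 : 0 < lam) (ha : 0 < a)
    (hal2 : a * (1 - a) * lam ^ 2 ≤ 1) :
    ∀ t : ℝ, a * lam * t ≤ 1 → 0 < (lam - 1) * t - (lam ^ 2 - lam - 1) →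
      0 < t - (lam - 1) + a * lam * ((lam - 1) * t - (lam ^ 2 - lam - 1)) →
      (∀ j < h, (rosenT lam a)^[j] (-t) < 0 ∧ rosenD lam a ((rosenT lam a)^[j] (-t)) = 1) ∧
      (rosenT lam a)^[h] (-t) =
        -((t - (lam - 1)) / ((lam - 1) * t - (lam ^ 2 - lam - 1))) := by
  have hqR : (q : ℝ) = 2 * h + 3 := by rw [hq]; push_cast; ring
  have hq0 : (0 : ℝ) < q := by rw [hqR]; positivity
  set θ : ℝ := π / q with hθ
  have hθq : q * θ = π := by rw [hθ]; field_simp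
  have hθ0 : 0 < θ := by positivity
  let s : ℕ → ℝ := fun k => sin (k * θ)
  have hs0 : s 0 = 0 := by simp [s]
  have hs : ∀ k, s (k + 2) = lam * s (k + 1) - s k := by
    intro k
    have e1 : ((k + 2 : ℕ) : ℝ) * θ = (k + 1 : ℕ) * θ + θ := by push_cast; ring
    have e2 : (k : ℝ) * θ = (k + 1 : ℕ) * θ - θ := by push_cast; ring
    simp only [s]
    rw [e1, e2, sin_add, sin_sub, hlam]
    ring
  have hspos : ∀ i, 0 < i → i ≤ h + 1 → 0 < s i := by
    intro i hi hih
    have hi' : (0 : ℝ) < i := by exact_mod_cast hi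
    have hih' : (i : ℝ) ≤ h + 1 := by exact_mod_cast hih
    apply sin_pos_of_pos_of_lt_pi (by positivity)
    rw [← hθq, hqR]
    exact mul_lt_mul_of_pos_right (by linarith) hθ0
  have hs1 : 0 < s 1 := hspos 1 one_pos (by omega)
  have hc : 0 < s (h + 1) := hspos _ h.succ_pos le_rfl
  have hsymm : s (h + 2) = s (h + 1) := by
    simp only [s]
    rw [← sin_pi_sub, ← hθq, hqR]
    congr 1
    push_cast
    ring
  have hsh : s h = (lam - 1) * s (h + 1) := by
    have := hs h
    linarith
  intro t h1 h2 h3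
  have e1 : s h * t - (lam * s h - s (h + 1))
      = s (h + 1) * ((lam - 1) * t - (lam ^ 2 - lam - 1)) := by rw [hsh]; ring
  have e2 : s (h + 1) * t - s h = s (h + 1) * (t - (lam - 1)) := by rw [hsh]; ring
  have := rosenD_eq_one_block hl0 ha hal2 hs0 hs1 hs h t
    (fun i hi hih => hspos i hi (hih.trans h.le_succ)) h1
    (by rw [e1]; positivity)
    (by rw [e1, e2]; nlinarith [mul_pos hc h3])
  rwa [e1, e2, mul_div_mul_left _ _ hc.ne'] at this

/-- The inequalities controlling the passage from the first block of digits `1`, which ends at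
`-N / D`, through the digit `2` to the point `-u`. -/
lemma rosen_second_block_bounds {lam a γ N D u : ℝ} (hl1 : 1 < lam) (hl2 : lam < 2)
    (ha : 0 < a) (ha1 : a ≤ 1 / 2) (hquad : 1 < lam ^ 2 * a ^ 2 + 2 * (2 - lam) * a)
    (hγ1 : a ≤ γ) (hγ2 : γ ≤ 1 - a) (hN' : N = 1 - γ * lam)
    (hD' : D = 1 - γ * lam * (lam - 1)) (hu : u = 2 * lam - D / N) :
    0 < N ∧ 0 < D ∧ (1 + a) * lam * N ≤ D ∧ u * N = 2 * lam * N - D ∧ u ≤ (1 - a) * lam ∧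
      0 < (lam - 1) * u - (lam ^ 2 - lam - 1) ∧
      0 < u - (lam - 1) + a * lam * ((lam - 1) * u - (lam ^ 2 - lam - 1)) := by
  have hl0 : 0 < lam := by linarith
  have hsq : lam - 1 < (a * lam) ^ 2 := by
    have := mul_le_mul_of_nonneg_left ha1 (sub_pos.2 hl2).le
    linarith
  have hal : lam - 1 < a * lam := by
    have hal0 : 0 < a * lam := mul_pos ha hl0
    refine lt_of_pow_lt_pow_left₀ 2 hal0.le (lt_of_le_of_lt ?_ hsq)
    nlinarith
  have hγlam : γ * lam ≤ (1 - a) * lam := mul_le_mul_of_nonneg_right hγ2 hl0.le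
  have hN : 0 < N := by rw [hN']; linarith
  have hDn : 0 < D := by
    rw [hD']
    have : 0 < γ * lam := mul_pos (by linarith) hl0
    have : 0 < γ * lam * (2 - lam) := mul_pos this (by linarith)
    linarith
  have hG : 0 < (2 * lam * N - D) * (1 + a * lam * (lam - 1))
      - N * ((lam - 1) + a * lam * (lam ^ 2 - lam - 1)) := by
    have : 0 < lam * (1 + a * (lam ^ 2 - 2 * lam + 2) - γ * (2 + a * lam ^ 2)) := by
      apply mul_pos hl0
      have : γ * (2 + a * lam ^ 2) ≤ (1 - a) * (2 + a * lam ^ 2) :=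
        mul_le_mul_of_nonneg_right hγ2 (by positivity)
      linarith
    rw [hN', hD']
    linarith
  have huN : u * N = 2 * lam * N - D := by rw [hu]; field_simp
  have hGu : 0 < u * (1 + a * lam * (lam - 1))
      - ((lam - 1) + a * lam * (lam ^ 2 - lam - 1)) := by
    rw [← huN] at hG
    have : 0 < N * (u * (1 + a * lam * (lam - 1))
      - ((lam - 1) + a * lam * (lam ^ 2 - lam - 1))) := by linarith
    exact pos_of_mul_pos_right this hN.le
  have hp : 0 < 1 + a * lam * (lam - 1) := by
    have : 0 < a * lam * (lam - 1) := mul_pos (mul_pos ha hl0) (by linarith)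
    linarith
  have huden : 0 < (lam - 1) * u - (lam ^ 2 - lam - 1) := by
    have h1 := mul_pos (sub_pos.2 hl1) hGu
    have : 0 < (1 + a * lam * (lam - 1)) * ((lam - 1) * u - (lam ^ 2 - lam - 1)) := by
      linarith
    exact pos_of_mul_pos_right this hp.le
  have hle2 : (1 + a) * lam * N ≤ D := by
    have h1 : 0 ≤ (γ - a) * lam := mul_nonneg (by linarith) hl0.le
    have h2 : a * a * lam ^ 2 ≤ a * γ * lam ^ 2 := by gcongr
    rw [hN', hD']
    linarith
  have hu_le : u ≤ (1 - a) * lam := by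
    have : (1 + a) * lam ≤ D / N := by rw [le_div_iff₀ hN]; exact hle2
    linarith
  exact ⟨hN, hDn, hle2, huN, hu_le, huden, by linarith⟩

/-- for odd `q = 2h+3`, `α ∈ (α₀, 1/2]`, the `T_α`-expansions of both `l₀` and
`−r₀` begin `[(−1:1)^h, (−1:2), (−1:1)^h, …]`. -/
theorem stmt9 (h q : ℕ) (hh : 1 ≤ h) (hq : q = 2 * h + 3)
    (lam : ℝ) (hlam : lam = 2 * Real.cos (Real.pi / (q : ℝ)))
    (a : ℝ)
    (ha0 : (lam - 2 + Real.sqrt (2 * lam ^ 2 - 4 * lam + 4)) / lam ^ 2 < a)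
    (ha1 : a ≤ 1 / 2) :
    ∀ x0 : ℝ, (x0 = (a - 1) * lam ∨ x0 = -(a * lam)) →
      (∀ j : ℕ, (j < h ∨ (h + 1 ≤ j ∧ j ≤ 2 * h)) →
        (rosenT lam a)^[j] x0 < 0 ∧ rosenD lam a ((rosenT lam a)^[j] x0) = 1) ∧
      ((rosenT lam a)^[h] x0 < 0 ∧ rosenD lam a ((rosenT lam a)^[h] x0) = 2) := by
  obtain ⟨hl1, hl2, hgold⟩ := two_mul_cos_pi_div_bounds (q := q) (by omega)
  rw [← hlam] at hl1 hl2 hgold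
  have hl0 : 0 < lam := by linarith
  obtain ⟨ha, hquad⟩ := pos_and_quadratic_of_rosen_bound_lt hl0 ha0
  have hal2 : a * (1 - a) * lam ^ 2 ≤ 1 := by
    have hlsq : lam ^ 2 ≤ 4 := by nlinarith
    have haa : a * (1 - a) ≤ 1 / 4 := by nlinarith [sq_nonneg (a - 1 / 2)]
    nlinarith [sq_nonneg lam]
  have hblock := rosenD_eq_one_block_of_odd hq hlam hl0 ha hal2
  have hle1 : ∀ t ≤ (1 - a) * lam, a * lam * t ≤ 1 := fun t ht => by
    nlinarith [mul_le_mul_of_nonneg_left ht (mul_pos ha hl0).le]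
  intro x0 hx0
  obtain ⟨γ, hγ1, hγ2, rfl⟩ : ∃ γ, a ≤ γ ∧ γ ≤ 1 - a ∧ x0 = -((1 - γ) * lam) := by
    rcases hx0 with rfl | rfl
    · exact ⟨a, le_rfl, by linarith, by ring⟩
    · exact ⟨1 - a, by linarith, le_rfl, by ring⟩
  obtain ⟨N, hN'⟩ : ∃ N, N = 1 - γ * lam := ⟨_, rfl⟩
  obtain ⟨D, hD'⟩ : ∃ D, D = 1 - γ * lam * (lam - 1) := ⟨_, rfl⟩
  obtain ⟨u, hu⟩ : ∃ u, u = 2 * lam - D / N := ⟨_, rfl⟩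
  obtain ⟨hN, hD, hle2, huN, hu_le, huden, hunum⟩ :=
    rosen_second_block_bounds hl1 hl2 ha ha1 hquad hγ1 hγ2 hN' hD' hu
  have eN : (1 - γ) * lam - (lam - 1) = N := by rw [hN']; ring
  have eD : (lam - 1) * ((1 - γ) * lam) - (lam ^ 2 - lam - 1) = D := by rw [hD']; ring
  obtain ⟨hfirst, hTh⟩ := hblock ((1 - γ) * lam)
    (hle1 _ (mul_le_mul_of_nonneg_right (by linarith) hl0.le)) (by rw [eD]; exact hD)
    (by rw [eN, eD]; positivity)
  rw [eN, eD] at hTh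
  have hu0 : 0 < u := pos_of_mul_pos_right (a := lam - 1) (by linarith) (by linarith)
  obtain ⟨hD2, hT2⟩ := rosenD_neg_eq_and_rosenT_neg_eq (lam := lam) (a := a) (t := N / D) 2 hl0
    (by positivity)
    (by push_cast; rw [← mul_div_assoc, div_le_one hD]; linarith)
    (by
      push_cast
      rw [← mul_div_assoc, one_lt_div hD]
      linarith [mul_pos hu0 hN, mul_pos (mul_pos ha hl0) hN])
  have hTh1 : (rosenT lam a)^[h + 1] (-((1 - γ) * lam)) = -u := by
    rw [Function.iterate_succ_apply', hTh, hT2, one_div_div, hu]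
    push_cast
    rfl
  obtain ⟨hsecond, -⟩ := hblock u (hle1 u hu_le) huden hunum
  refine ⟨fun j hj => ?_, ?_⟩
  · rcases hj with hj | ⟨hj1, hj2⟩
    · exact hfirst j hj
    · obtain ⟨i, rfl⟩ := Nat.exists_eq_add_of_le' hj1
      rw [Function.iterate_add_apply, hTh1]
      exact hsecond i (by omega)
  · rw [hTh]
    exact ⟨neg_neg_of_pos (by positivity), hD2⟩
end

section
/- Let q = 2h+3 with h ≥ 1 be an odd integer, λ = 2cos(π/q), and let α ∈ (α₀, 1/2]. Then T_α^{2h}(−αλ) = (−αλ² + 2(λ−1))/(αλ³ − 2αλ + (3 − 2λ)λ). -/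
open Real MeasureTheory Set

/-- On negative `x`, the digit is the integer `d` that puts `-1/x - λd` into `[(α-1)λ, αλ)`. -/
lemma rosenT_eq_of_neg {lam a x : ℝ} {d : ℤ} (hl : 0 < lam) (hx : x < 0)
    (h1 : (a - 1) * lam ≤ -1 / x - lam * d) (h2 : -1 / x - lam * d < a * lam) :
    rosenT lam a x = -1 / x - lam * d := by
  have habs : |1 / x| = -1 / x := by
    rw [abs_of_neg (one_div_neg.mpr hx), neg_div]
  have habs' : |1 / (lam * x)| = -1 / x / lam := by
    rw [← habs, mul_comm, ← div_div, abs_div, abs_of_pos hl]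
  have hd : rosenD lam a x = d := by
    rw [rosenD, habs', Int.floor_eq_iff]
    have hy : -1 / x / lam * lam = -1 / x := div_mul_cancel₀ _ hl.ne'
    constructor <;> nlinarith
  rw [rosenT, if_neg hx.ne, habs, hd]

/-- As long as a positive solution of `w (n+2) = λ w (n+1) - w n` persists, all the digits
of the orbit of `-w 1 / w 0` equal `1` and the orbit is `-w (n+1) / w n`. -/
lemma rosenT_iterate_of_recurrence {lam a : ℝ} (hl : 0 < lam) (hl2 : lam < 2) (ha : 0 < a)
    {w : ℕ → ℝ} (hw : ∀ n, w (n + 2) = lam * w (n + 1) - w n) {m : ℕ}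
    (hpos : ∀ n ≤ m + 1, 0 < w n) (h0 : (a - 1) * lam ≤ -w 1 / w 0) :
    (rosenT lam a)^[m] (-w 1 / w 0) = -w (m + 1) / w m := by
  suffices H : ∀ n ≤ m, (rosenT lam a)^[n] (-w 1 / w 0) = -w (n + 1) / w n ∧
      (a - 1) * lam ≤ -w (n + 1) / w n from (H m le_rfl).1
  intro n
  induction n with
  | zero => exact fun _ => ⟨rfl, h0⟩
  | succ n ih =>
    intro hn
    obtain ⟨hit, hlow⟩ := ih (by omega)
    have p0 := hpos n (by omega)
    have p1 := hpos (n + 1) (by omega)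
    have p2 := hpos (n + 2) (by omega)
    have hstep : -1 / (-w (n + 1) / w n) - lam * ((1 : ℤ) : ℝ) = -w (n + 2) / w (n + 1) := by
      rw [hw n]
      field_simp
      push_cast
      ring
    have hmono : -w (n + 1) / w n ≤ -w (n + 2) / w (n + 1) := by
      rw [div_le_div_iff₀ p0 p1, hw n]
      nlinarith [sq_nonneg (w (n + 1) - w n), mul_pos p0 p1]
    have hneg : -w (n + 2) / w (n + 1) < 0 := div_neg_of_neg_of_pos (by linarith) p1
    have hlow' := hlow.trans hmono
    refine ⟨?_, hlow'⟩
    rw [Function.iterate_succ_apply', hit, rosenT_eq_of_neg hl (d := 1), hstep]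
    · exact div_neg_of_neg_of_pos (by linarith) p0
    · rwa [hstep]
    · rw [hstep]
      exact hneg.trans (mul_pos ha hl)

/-- The orbit of `-w 1 / w 0` for `w n = P sin((K-n)θ) + Q sin(nθ)` with `K = m + 1`. -/
lemma rosenT_iterate_sin {a θ P Q : ℝ} (ha : 0 < a) (hθ : 0 < θ) (hl : 0 < 2 * cos θ) {m : ℕ}
    (hm : (m + 1) * θ < π) (hP : 0 < P) (hQ : 0 < Q)
    (h0 : (a - 1) * (2 * cos θ) ≤
      -(P * sin (m * θ) + Q * sin θ) / (P * sin ((m + 1) * θ))) :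
    (rosenT (2 * cos θ) a)^[m] (-(P * sin (m * θ) + Q * sin θ) / (P * sin ((m + 1) * θ))) =
      -(Q * sin ((m + 1) * θ)) / (P * sin θ + Q * sin (m * θ)) := by
  have hθπ : θ < π := by
    have : (0 : ℝ) ≤ m * θ := by positivity
    linarith
  have hl2 : 2 * cos θ < 2 := by
    have := cos_lt_cos_of_nonneg_of_le_pi le_rfl hθπ.le hθ
    rw [cos_zero] at this
    linarith
  have key := rosenT_iterate_of_recurrence (a := a) hl hl2 ha
    (w := fun n => P * sin ((m + 1 - n) * θ) + Q * sin (n * θ)) (m := m) ?_ ?_ ?_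
  · convert key using 2 <;> simp
  · intro n
    have e1 : ((m : ℝ) + 1 - (n + 2 : ℕ)) * θ = (m + 1 - (n + 1 : ℕ)) * θ - θ := by
      push_cast; ring
    have e2 : ((m : ℝ) + 1 - n) * θ = (m + 1 - (n + 1 : ℕ)) * θ + θ := by
      push_cast; ring
    have e3 : ((n + 2 : ℕ) : ℝ) * θ = (n + 1 : ℕ) * θ + θ := by
      push_cast; ring
    have e4 : (n : ℝ) * θ = (n + 1 : ℕ) * θ - θ := by
      push_cast; ring
    rw [e1, e2, e3, e4, sin_sub, sin_add, sin_add, sin_sub]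
    ring
  · intro n hn
    have hnm : (n : ℝ) ≤ m + 1 := by exact_mod_cast hn
    have b1 : (n : ℝ) * θ ≤ (m + 1) * θ := by gcongr
    have s1 : 0 ≤ sin (n * θ) := sin_nonneg_of_nonneg_of_le_pi (by positivity) (by linarith)
    rcases Nat.eq_zero_or_pos n with rfl | hn0
    · have : 0 < sin ((m + 1) * θ) := sin_pos_of_pos_of_lt_pi (by positivity) hm
      simpa using mul_pos hP this
    · have s2 : 0 < sin (n * θ) := sin_pos_of_pos_of_lt_pi (by positivity) (by linarith)
      have s3 : 0 ≤ sin ((m + 1 - n) * θ) :=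
        sin_nonneg_of_nonneg_of_le_pi (mul_nonneg (by linarith) hθ.le)
          (by nlinarith [mul_nonneg (Nat.cast_nonneg (α := ℝ) n) hθ.le])
      positivity
  · simpa using h0

/-- for odd `q = 2h+3`, `α ∈ (α₀, 1/2]`,
`T_α^{2h}(−αλ) = (−αλ² + 2(λ−1))/(αλ³ − 2αλ + (3 − 2λ)λ)`. -/
theorem stmt10 (h q : ℕ) (hh : 1 ≤ h) (hq : q = 2 * h + 3)
    (lam : ℝ) (hlam : lam = 2 * Real.cos (Real.pi / (q : ℝ)))
    (a : ℝ)
    (ha0 : (lam - 2 + Real.sqrt (2 * lam ^ 2 - 4 * lam + 4)) / lam ^ 2 < a)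
    (ha1 : a ≤ 1 / 2) :
    (rosenT lam a)^[2 * h] (-(a * lam)) =
      (-(a * lam ^ 2) + 2 * (lam - 1)) / (a * lam ^ 3 - 2 * a * lam + (3 - 2 * lam) * lam) := by
  obtain ⟨k, rfl⟩ : ∃ k, h = k + 1 := ⟨h - 1, by omega⟩
  set θ := π / (q : ℝ) with hθdef
  have hqθ : (2 * (k : ℝ) + 5) * θ = π := by
    have : (q : ℝ) = 2 * k + 5 := by rw [hq]; push_cast; ring
    rw [hθdef, this]
    field_simp
  have hθ : 0 < θ := by
    have : (0 : ℝ) < 2 * k + 5 := by positivity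
    exact pos_of_mul_pos_right (hqθ ▸ pi_pos) this.le
  have hkθ : 0 ≤ (k : ℝ) * θ := by positivity
  have hsθ : 0 < sin θ := sin_pos_of_pos_of_lt_pi hθ (by linarith)
  set s := sin ((k + 2) * θ) with hs
  have s_pos : 0 < s := sin_pos_of_pos_of_lt_pi (by positivity) (by linarith)
  have s3 : sin ((k + 3) * θ) = s := by
    rw [hs, ← sin_pi_sub]
    congr 1
    linarith
  have s_rec : ∀ x : ℝ, sin (x * θ) = lam * sin ((x + 1) * θ) - sin ((x + 2) * θ) := by
    intro x
    have e1 : x * θ = (x + 1) * θ - θ := by ring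
    have e2 : (x + 2) * θ = (x + 1) * θ + θ := by ring
    rw [e1, e2, sin_sub, sin_add, hlam]
    ring
  have s1 : sin ((k + 1) * θ) = (lam - 1) * s := by
    rw [s_rec, show (k : ℝ) + 1 + 1 = k + 2 by ring, show (k : ℝ) + 1 + 2 = k + 3 by ring, s3]
    ring
  have s0 : sin (k * θ) = (lam ^ 2 - lam - 1) * s := by
    rw [s_rec, s1, ← hs]
    ring
  have s_sq : sin θ ^ 2 = (2 - lam) * s ^ 2 := by
    have e : θ = (k + 3) * θ - (k + 2) * θ := by ring
    have hc3 : cos ((k + 3) * θ) = - cos ((k + 2) * θ) := by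
      rw [← cos_pi_sub]
      congr 1
      linarith
    have h1 : sin θ = 2 * s * cos ((k + 2) * θ) := by
      conv_lhs => rw [e, sin_sub, s3, hc3, ← hs]
      ring
    have h2 : lam / 2 = s ^ 2 - cos ((k + 2) * θ) ^ 2 := by
      have : cos θ = s ^ 2 - cos ((k + 2) * θ) ^ 2 := by
        conv_lhs => rw [e, cos_sub, s3, hc3, ← hs]
        ring
      linarith
    have h3 : s ^ 2 + cos ((k + 2) * θ) ^ 2 = 1 := sin_sq_add_cos_sq _
    rw [h1]
    linear_combination 2 * s ^ 2 * (h3 + h2)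
  have hl1 : 1 < lam := by
    have : 0 < sin ((k + 1) * θ) := sin_pos_of_pos_of_lt_pi (by positivity) (by linarith)
    rw [s1] at this
    linarith [pos_of_mul_pos_left this s_pos.le]
  have hl2 : lam < 2 := by
    have : 0 < (2 - lam) * s ^ 2 := s_sq ▸ by positivity
    linarith [pos_of_mul_pos_left this (sq_nonneg s)]
  have hl3 : 0 ≤ lam ^ 2 - lam - 1 := by
    have : 0 ≤ sin (k * θ) := sin_nonneg_of_nonneg_of_le_pi hkθ (by linarith)
    rw [s0] at this
    exact nonneg_of_mul_nonneg_left this s_pos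
  have hl : 0 < lam := by linarith
  have hc : 0 < a * lam ^ 2 - 2 * lam + 2 := by
    rw [div_lt_iff₀ (by positivity)] at ha0
    have : lam ≤ √(2 * lam ^ 2 - 4 * lam + 4) :=
      le_sqrt_of_sq_le (by nlinarith [sq_nonneg (lam - 2)])
    linarith
  have ha : 0 < a := pos_of_mul_pos_left (by linarith : 0 < a * lam ^ 2) (by positivity)
  have hv : 0 < a * lam - lam + 1 := by nlinarith
  set c := a * lam ^ 2 - 2 * lam + 2 with hcdef
  set v := a * lam - lam + 1 with hvdef
  have hu : 0 < (2 - lam) + v * (lam - 1) := by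
    have := mul_pos hv (by linarith : 0 < lam - 1)
    linarith
  have hd : 0 < (2 - lam) * v + c * (lam ^ 2 - lam - 1) := by
    have := mul_pos (by linarith : 0 < 2 - lam) hv
    have := mul_nonneg hc.le hl3
    linarith
  have start1 : -(sin θ * sin ((k + 1) * θ) + v * s * sin θ) / (sin θ * s) = -(a * lam) := by
    rw [s1]
    field_simp
    rw [hvdef]
    ring
  have phase1 : (rosenT lam a)^[k + 1] (-(a * lam)) = -v / ((2 - lam) + v * (lam - 1)) := by
    have := rosenT_iterate_sin (P := sin θ) (Q := v * s) (m := k + 1) ha hθ (by linarith)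
      (by push_cast; linarith) hsθ (by positivity)
    push_cast at this
    rw [show (k : ℝ) + 1 + 1 = k + 2 by ring, ← hs, start1, ← hlam] at this
    rw [this (by nlinarith), s1, ← sq, s_sq,
      show (2 - lam) * s ^ 2 + v * s * ((lam - 1) * s) = s ^ 2 * ((2 - lam) + v * (lam - 1))
        by ring, show -(v * s * s) = s ^ 2 * -v by ring, mul_div_mul_left _ _ (by positivity)]
  set y := -(v * (lam ^ 2 - lam - 1) + c) / (v * (lam - 1)) with hy
  have hden : 0 < v * (lam - 1) := mul_pos hv (by linarith)
  have hstep : -1 / (-v / ((2 - lam) + v * (lam - 1))) - lam * ((2 : ℤ) : ℝ) = y := by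
    have : lam - 1 ≠ 0 := by linarith
    rw [hy]
    field_simp
    rw [hcdef, hvdef]
    push_cast
    ring
  have hylow : (a - 1) * lam ≤ y := by
    rw [hy, le_div_iff₀ hden]
    have h1 : 0 ≤ 1 - a ^ 2 * lam ^ 2 + a * lam ^ 2 - 2 * a * lam := by
      have : 0 ≤ lam * (1 / 2 - a) * (2 - lam * (1 / 2 - a)) :=
        mul_nonneg (mul_nonneg hl.le (by linarith)) (by nlinarith)
      nlinarith [sq_nonneg (1 - lam / 2)]
    have h2 := mul_nonneg h1 (by linarith : 0 ≤ lam - 1)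
    rw [hcdef, hvdef]
    linarith
  have hyneg : y < 0 := by
    have := mul_nonneg hv.le hl3
    exact div_neg_of_neg_of_pos (by linarith) hden
  have middle : rosenT lam a (-v / ((2 - lam) + v * (lam - 1))) = y := by
    rw [rosenT_eq_of_neg hl (d := 2), hstep]
    · exact div_neg_of_neg_of_pos (by linarith) hu
    · rwa [hstep]
    · rw [hstep]
      exact hyneg.trans (mul_pos ha hl)
  have start2 : -(v * sin θ * sin (k * θ) + c * s * sin θ) / (v * sin θ * sin ((k + 1) * θ)) =
      y := by
    have : lam - 1 ≠ 0 := by linarith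
    rw [s0, s1, hy]
    field_simp
  have phase2 : (rosenT lam a)^[k] y =
      -(c * (lam - 1)) / ((2 - lam) * v + c * (lam ^ 2 - lam - 1)) := by
    have := rosenT_iterate_sin (P := v * sin θ) (Q := c * s) (m := k) ha hθ (by linarith)
      (by linarith) (by positivity) (by positivity)
    rw [start2, ← hlam] at this
    rw [this hylow, s0, s1, mul_assoc v, ← sq, s_sq,
      show v * ((2 - lam) * s ^ 2) + c * s * ((lam ^ 2 - lam - 1) * s) =
        s ^ 2 * ((2 - lam) * v + c * (lam ^ 2 - lam - 1)) by ring,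
      show -(c * s * ((lam - 1) * s)) = s ^ 2 * -(c * (lam - 1)) by ring,
      mul_div_mul_left _ _ (by positivity)]
  rw [show 2 * (k + 1) = k + 1 + (k + 1) by ring, Function.iterate_add_apply, phase1,
    Function.iterate_succ_apply, middle, phase2]
  have hl1' : lam - 1 ≠ 0 := by linarith
  have hfac : (2 - lam) * v + c * (lam ^ 2 - lam - 1) =
      (a * lam ^ 3 - 2 * a * lam + (3 - 2 * lam) * lam) * (lam - 1) := by
    rw [hcdef, hvdef]
    ring
  rw [hfac, ← neg_mul, mul_div_mul_right _ _ hl1', hcdef]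
  congr 1
  ring
end

section
/- Let q = 3 (so λ = 1) and let α ∈ [√2 − 1, 1/2). Then, up to a set of two-dimensional Lebesgue measure zero, the basic added region is the rectangle 𝒯_α(C) = [α−1, −1/2) × [0, g²). -/
open Real MeasureTheory Set
open scoped symmDiff

/-- The small golden number `g = (√5 − 1)/2`. -/
noncomputable def gold : ℝ := (Real.sqrt 5 - 1) / 2

/-- The NICF natural-extension domain `Ω_{1/2}` for `q = 3`. -/
noncomputable def Omega3 : Set (ℝ × ℝ) :=
  Set.Ico (-(1 : ℝ) / 2) 0 ×ˢ Set.Ico (0 : ℝ) (gold ^ 2) ∪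
    Set.Ico (0 : ℝ) (1 / 2) ×ˢ Set.Ico (0 : ℝ) gold

theorem gold_pos : 0 < gold := by
  have h : (2 : ℝ) < √5 := Real.lt_sqrt_of_sq_lt (by norm_num)
  unfold gold
  linarith

theorem gold_sq : gold ^ 2 = 1 - gold := by
  have h : √5 ^ 2 = 5 := Real.sq_sqrt (by norm_num)
  unfold gold
  linarith [show ((√5 - 1) / 2) ^ 2 = (√5 ^ 2 - 2 * √5 + 1) / 4 by ring]

theorem gold_lt_one : gold < 1 := by
  nlinarith [gold_sq, gold_pos]

theorem one_div_two_add_gold : 1 / (2 + gold) = gold ^ 2 := by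
  have h := gold_pos
  rw [div_eq_iff (by positivity)]
  linear_combination (-gold - 1) * gold_sq

/-- A changed digit lies one above the nearest-integer digit and is at least `3`. -/
theorem rosenD_bounds_of_ne {a x : ℝ} (ha : a < 1 / 2) (hx0 : x ≠ 0) (hx : |x| ≤ 1 / 2)
    (hd : rosenD 1 a x ≠ rosenD 1 (1 / 2) x) :
    a - 1 ≤ rosenT 1 a x ∧ rosenT 1 a x < -1 / 2 ∧ 3 ≤ rosenD 1 a x := by
  have hT : rosenT 1 a x = |1 / x| - rosenD 1 a x := by simp [rosenT, hx0]
  have hu : 2 ≤ |1 / x| := by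
    rw [abs_div, abs_one, le_div_iff₀ (abs_pos.2 hx0)]
    linarith
  have hlt : rosenD 1 (1 / 2) x < rosenD 1 a x := by
    refine lt_of_le_of_ne (Int.floor_le_floor ?_) hd.symm
    linarith
  have h₁ : (rosenD 1 a x : ℝ) ≤ |1 / x| + 1 - a := by
    simpa [rosenD] using Int.floor_le (|1 / (1 * x)| + 1 - a)
  have h₂ : |1 / x| + 1 - 1 / 2 < rosenD 1 a x := by
    have := Int.floor_lt.1 hlt
    rwa [one_mul] at this
  have h₃ : (2 : ℝ) < rosenD 1 a x := by linarith
  rw [hT]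
  exact ⟨by linarith, by linarith, by exact_mod_cast h₃⟩

theorem rosenTT_image_changedDigits_subset {a : ℝ} (ha1 : a < 1 / 2) :
    rosenTT 1 a '' changedDigits 1 a Omega3 ⊆
      Ico (a - 1) (-(1 : ℝ) / 2) ×ˢ Ico (0 : ℝ) (gold ^ 2) := by
  rintro _ ⟨⟨x, y⟩, ⟨hOm, hx0, -, hx, hd⟩, rfl⟩
  simp only [mul_one, mem_Ico] at hx hx0 hd
  obtain ⟨h₁, h₂, h₃⟩ :=
    rosenD_bounds_of_ne ha1 hx0 (abs_le.2 ⟨by linarith [hx.1], hx.2.le⟩) hd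
  have h₃' : (3 : ℝ) ≤ rosenD 1 a x := by exact_mod_cast h₃
  have hg := gold_pos
  have hg1 := gold_lt_one
  have hden : 2 + gold < rosenD 1 a x * 1 + Real.sign x * y := by
    rcases hOm with ⟨h, hy⟩ | ⟨h, hy⟩ <;> simp only [mem_Ico] at h hy
    · rw [Real.sign_of_neg h.2]
      linarith [gold_sq]
    · rw [Real.sign_of_pos (lt_of_le_of_ne h.1 hx0.symm)]
      linarith
  refine ⟨⟨h₁, h₂⟩, one_div_nonneg.2 (by linarith), ?_⟩
  rw [← one_div_two_add_gold]
  exact one_div_lt_one_div_of_lt (by linarith) hden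

/-- The point with digit `d`, first image coordinate `t` and sign `s` has changed digit. -/
theorem rosenTT_mem_image {a t y s : ℝ} {d : ℤ} (ha0 : 0 < a) (ha1 : a < 1 / 2)
    (ht : a - 1 ≤ t) (ht' : t < -1 / 2) (hdt : 0 < d + t) (hs : s = 1 ∨ s = -1)
    (hI : s / (d + t) ∈ Ico (-(1 : ℝ) / 2) a) (hOm : (s / (d + t), y) ∈ Omega3) :
    (t, 1 / (d + s * y)) ∈ rosenTT 1 a '' changedDigits 1 a Omega3 := by
  have hs0 : s ≠ 0 := by rcases hs with rfl | rfl <;> norm_num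
  have hx0 : s / (d + t) ≠ 0 := div_ne_zero hs0 hdt.ne'
  have habs : |1 / (s / (d + t))| = d + t := by
    rw [one_div_div, abs_div, abs_of_pos hdt]
    rcases hs with rfl | rfl <;> simp
  have hsign : Real.sign (s / (d + t)) = s := by
    rcases hs with rfl | rfl
    · exact Real.sign_of_pos (by positivity)
    · exact Real.sign_of_neg (div_neg_of_neg_of_pos (by norm_num) hdt)
  have hda : rosenD 1 a (s / (d + t)) = d := by
    rw [rosenD, one_mul, habs, Int.floor_eq_iff]
    constructor <;> linarith
  have hdh : rosenD 1 (1 / 2) (s / (d + t)) ≠ d := by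
    refine (Int.floor_lt.2 ?_).ne
    rw [one_mul, habs]
    linarith
  refine ⟨(s / (d + t), y), ⟨hOm, hx0, ?_, ?_, ?_⟩, ?_⟩
  · simp only [mul_one]
    exact ⟨by linarith [hI.1], hI.2⟩
  · simp only [mul_one]
    exact ⟨by linarith [hI.1], by linarith [hI.2]⟩
  · rw [hda]
    exact hdh.symm
  · simp only [rosenTT, hda, hsign, rosenT, if_neg hx0, habs]
    simp

theorem mem_rosenTT_image_of_generic {a t v : ℝ} (ha0 : 0 < a) (ha : 1 ≤ a * (2 + a))
    (ha1 : a < 1 / 2) (ht : a - 1 < t) (ht' : t < -1 / 2) (hv : 0 < v) (hv' : v < gold ^ 2)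
    (hgen : ∀ n : ℤ, v ≠ 1 / (n + gold)) :
    (t, v) ∈ rosenTT 1 a '' changedDigits 1 a Omega3 := by
  have hg := gold_pos
  have hg1 := gold_lt_one
  have hw : 2 + gold < 1 / v := by
    rw [← one_div_two_add_gold] at hv'
    exact (lt_one_div hv (by linarith)).1 hv'
  set d : ℤ := ⌊1 / v + (1 - gold)⌋
  have hd3 : (3 : ℝ) ≤ d := by
    have : (3 : ℤ) ≤ d := Int.le_floor.2 (by push_cast; linarith)
    exact_mod_cast this
  have hlow : (d : ℝ) < 1 / v + (1 - gold) := by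
    refine lt_of_le_of_ne (Int.floor_le _) fun h => hgen (d - 1) ?_
    rw [show ((d - 1 : ℤ) : ℝ) + gold = 1 / v by push_cast; linarith, one_div_one_div]
  have hhigh : 1 / v + (1 - gold) < d + 1 := Int.lt_floor_add_one _
  have hdt : 2 + a < d + t := by linarith
  have hdt0 : 0 < d + t := by linarith
  have hinv : 1 / (d + t) < a := by
    rw [div_lt_iff₀ hdt0]
    nlinarith
  have hpos : 0 < 1 / (d + t) := by positivity
  rcases lt_or_ge (1 / v) d with h | h
  · have hOm : (-1 / (d + t), d - 1 / v) ∈ Omega3 := by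
      refine Or.inl ⟨⟨?_, ?_⟩, ?_, ?_⟩ <;> simp only [neg_div] <;> linarith [gold_sq]
    have hI : -1 / (d + t) ∈ Ico (-(1 : ℝ) / 2) a := by
      rw [neg_div (d + t : ℝ)]
      constructor <;> linarith
    simpa using rosenTT_mem_image ha0 ha1 ht.le ht' hdt0 (Or.inr rfl) hI hOm
  · have hOm : (1 / (d + t), 1 / v - d) ∈ Omega3 := by
      refine Or.inr ⟨⟨?_, ?_⟩, ?_, ?_⟩ <;> dsimp only <;> linarith
    have hI : 1 / (d + t) ∈ Ico (-(1 : ℝ) / 2) a := by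
      constructor <;> linarith
    simpa using rosenTT_mem_image ha0 ha1 ht.le ht' hdt0 (Or.inl rfl) hI hOm

theorem volume_singleton_prod_union_prod_countable (c : ℝ) {S : Set ℝ} (hS : S.Countable) :
    volume (({c} ×ˢ univ ∪ univ ×ˢ S : Set (ℝ × ℝ))) = 0 := by
  rw [measure_union_null_iff, Measure.volume_eq_prod]
  simp [Measure.prod_prod, hS.measure_zero]

/-- for `q = 3` (so `λ = 1`) and `α ∈ [√2 − 1, 1/2)`, up to Lebesgue measure
zero the basic added region is `𝒯_α(C) = [α−1, −1/2) × [0, g²)`. -/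
theorem stmt15 (lam : ℝ) (hlam : lam = 2 * Real.cos (Real.pi / 3))
    (a : ℝ) (ha0 : Real.sqrt 2 - 1 ≤ a) (ha1 : a < 1 / 2) :
    volume ((rosenTT lam a '' changedDigits lam a Omega3) ∆
      (Set.Ico (a - 1) (-(1 : ℝ) / 2) ×ˢ Set.Ico (0 : ℝ) (gold ^ 2))) = 0 := by
  have hlam1 : lam = 1 := by
    rw [hlam, Real.cos_pi_div_three]
    norm_num
  subst hlam1
  have hsq : √2 ^ 2 = 2 := Real.sq_sqrt (by norm_num)
  have h1 : (1 : ℝ) < √2 := Real.lt_sqrt_of_sq_lt (by norm_num)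
  have hapos : 0 < a := by linarith
  have ha : 1 ≤ a * (2 + a) := by nlinarith
  have hS : (insert 0 (range fun n : ℤ => 1 / ((n : ℝ) + gold))).Countable :=
    (countable_range _).insert 0
  refine measure_mono_null ?_ (volume_singleton_prod_union_prod_countable (a - 1) hS)
  rw [Set.symmDiff_def, sdiff_eq_empty.2 (rosenTT_image_changedDigits_subset ha1),
    empty_union]
  rintro ⟨t, v⟩ ⟨⟨ht, hv⟩, hnot⟩
  by_contra hgen
  simp only [mem_union, mem_prod, mem_singleton_iff, mem_univ, and_true, true_and,
    mem_insert_iff, mem_range, not_or, not_exists] at hgen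
  exact hnot (mem_rosenTT_image_of_generic hapos ha ha1 (lt_of_le_of_ne ht.1 (Ne.symm hgen.1))
    ht.2 (lt_of_le_of_ne hv.1 (Ne.symm hgen.2.1)) hv.2 fun n h => hgen.2.2 n h.symm)
end

section
/- Let q = 3 (so λ = 1) and let α ∈ [√2 − 1, 1/2). With A_0 = [α−1, −1/2) × [0, g²) and D_0 = [α, 1/2) × [0, g), one has 𝒯_α²(A_0) = 𝒯_α²(D_0) up to a set of two-dimensional Lebesgue measure zero. -/
open Real MeasureTheory Set
open scoped symmDiff

/-- To the left of `-1/2` the digit is `2`. -/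
theorem rosenD_sub_one {a x : ℝ} (hx : a ≤ x) (hx0 : 0 < x) (hx2 : x < 1 / 2) (ha : 0 < a) :
    rosenD 1 a (x - 1) = 2 := by
  have h1 : |1 / (1 * (x - 1))| = 1 / (1 - x) := by
    rw [one_mul, abs_div, abs_one, abs_of_neg (by linarith), neg_sub]
  have h2 : 1 + x ≤ 1 / (1 - x) := by
    rw [le_div_iff₀ (by linarith)]
    nlinarith
  have h3 : 1 / (1 - x) < 2 := by
    rw [div_lt_iff₀ (by linarith)]
    linarith
  rw [rosenD, h1, Int.floor_eq_iff]
  push_cast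
  constructor <;> linarith

/-- Strictly between `a` and `1/2` the digit is `2`. -/
theorem rosenD_of_lt {a x : ℝ} (hx : a < x) (hx2 : x < 1 / 2) (ha : 0 < a)
    (ha2 : 1 ≤ a * (a + 2)) : rosenD 1 a x = 2 := by
  have hx0 : 0 < x := ha.trans hx
  have h1 : |1 / (1 * x)| = 1 / x := by
    rw [one_mul, abs_of_pos (by positivity)]
  have h2 : 2 < 1 / x := by
    rw [lt_div_iff₀ hx0]
    linarith
  have h3 : 1 / x < a + 2 := by
    rw [div_lt_iff₀ hx0]
    nlinarith
  rw [rosenD, h1, Int.floor_eq_iff]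
  push_cast
  constructor <;> linarith

/-- Two points of opposite sign whose inverses have absolute values differing by one have the same
image under the planar map, provided the second coordinates correspond. -/
theorem rosenTT_eq_of_abs_inv {a u v s t : ℝ} (hu : u < 0) (hv : 0 < v)
    (huv : |1 / u| = |1 / v| + 1) (hst : 1 - s = t) :
    rosenTT 1 a (u, s) = rosenTT 1 a (v, t) := by
  have hd : rosenD 1 a u = rosenD 1 a v + 1 := by
    unfold rosenD
    rw [one_mul, one_mul, huv, ← Int.floor_add_one]
    congr 1
    ring
  ext
  · simp only [rosenTT, rosenT, if_neg hu.ne, if_neg hv.ne', hd, huv]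
    push_cast
    ring
  · simp only [rosenTT, hd, Real.sign_of_neg hu, Real.sign_of_pos hv, ← hst]
    push_cast
    congr 1
    ring

theorem rosenTT_iterate_two_sub_one {a x y : ℝ} (hx : a < x) (hx2 : x < 1 / 2) (ha : 0 < a)
    (ha2 : 1 ≤ a * (a + 2)) (hy1 : y < 1) :
    (rosenTT 1 a)^[2] (x - 1, y) = (rosenTT 1 a)^[2] (x, y / (1 - y)) := by
  have hx0 : 0 < x := ha.trans hx
  have hA : rosenTT 1 a (x - 1, y) = ((2 * x - 1) / (1 - x), 1 / (2 - y)) := by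
    have h1 : |1 / (x - 1)| = 1 / (1 - x) := by
      rw [abs_div, abs_one, abs_of_neg (by linarith), neg_sub]
    have h2 : 1 - x ≠ 0 := by linarith
    simp only [rosenTT, rosenT, rosenD_sub_one hx.le hx0 hx2 ha, h1,
      if_neg (show x - 1 ≠ 0 by linarith), Real.sign_of_neg (show x - 1 < 0 by linarith)]
    ext
    · push_cast
      field_simp
      ring
    · push_cast
      congr 1
      ring
  have hD : rosenTT 1 a (x, y / (1 - y)) = ((1 - 2 * x) / x, 1 / (2 + y / (1 - y))) := by
    simp only [rosenTT, rosenT, rosenD_of_lt hx hx2 ha ha2, if_neg hx0.ne',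
      Real.sign_of_pos hx0, abs_of_pos (one_div_pos.mpr hx0)]
    ext
    · push_cast
      field_simp
    · push_cast
      congr 1
      ring
  have hu : (2 * x - 1) / (1 - x) < 0 := div_neg_of_neg_of_pos (by linarith) (by linarith)
  have hv : 0 < (1 - 2 * x) / x := div_pos (by linarith) hx0
  simp only [Function.iterate_succ, Function.iterate_zero, Function.comp_apply, id, hA, hD]
  apply rosenTT_eq_of_abs_inv hu hv
  · rw [abs_of_neg (one_div_neg.mpr hu), abs_of_pos (one_div_pos.mpr hv), one_div_div, one_div_div,
      ← neg_sub 1 (2 * x), div_neg, neg_neg]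
    rw [div_add_one (show 1 - 2 * x ≠ 0 by linarith)]
    congr 1
    ring
  · have h1 : 1 - y ≠ 0 := by linarith
    have h2 : 2 - y ≠ 0 := by linarith
    have h3 : 2 + y / (1 - y) = (2 - y) / (1 - y) := by
      field_simp
      ring
    rw [h3, one_div_div]
    field_simp
    ring

theorem rosenTT_iterate_two_fst (lam a x y : ℝ) :
    ((rosenTT lam a)^[2] (x, y)).1 = rosenT lam a (rosenT lam a x) := rfl

theorem volume_finite_prod_univ {s : Set ℝ} (hs : s.Finite) :
    volume (s ×ˢ (univ : Set ℝ)) = 0 := by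
  rw [Measure.volume_eq_prod, Measure.prod_prod, hs.measure_zero, zero_mul]

/-- for `q = 3` (so `λ = 1`) and `α ∈ [√2 − 1, 1/2)`, with
`A₀ = [α−1, −1/2) × [0, g²)` and `D₀ = [α, 1/2) × [0, g)`, one has
`𝒯_α²(A₀) = 𝒯_α²(D₀)` up to a set of two-dimensional Lebesgue measure zero. -/
theorem stmt17 (lam : ℝ) (hlam : lam = 2 * Real.cos (Real.pi / 3))
    (a : ℝ) (ha0 : Real.sqrt 2 - 1 ≤ a) (ha1 : a < 1 / 2) :
    volume
      (((rosenTT lam a)^[2] ''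
          (Set.Ico (a - 1) (-(1 : ℝ) / 2) ×ˢ Set.Ico (0 : ℝ) (gold ^ 2))) ∆
        ((rosenTT lam a)^[2] ''
          (Set.Ico a (1 / 2 : ℝ) ×ˢ Set.Ico (0 : ℝ) gold))) = 0 := by
  have hl : lam = 1 := by
    rw [hlam, Real.cos_pi_div_three]
    norm_num
  subst hl
  have hs2 : Real.sqrt 2 ^ 2 = 2 := Real.sq_sqrt (by norm_num)
  have hs1 : 1 < Real.sqrt 2 := by
    rw [Real.lt_sqrt (by norm_num)]
    norm_num
  have ha : 0 < a := by linarith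
  have ha2 : 1 ≤ a * (a + 2) := by nlinarith
  have hg := gold_pos
  have hg2 := gold_sq
  have hg0 : gold < 1 := by nlinarith
  refine measure_mono_null ?_ (volume_finite_prod_univ
    (Set.toFinite {rosenT 1 a (rosenT 1 a (a - 1)), rosenT 1 a (rosenT 1 a a)}))
  rintro p (⟨⟨⟨x, y⟩, ⟨⟨hx1, hx2⟩, hy1, hy2⟩, rfl⟩, hp⟩ | ⟨⟨⟨x, y⟩, ⟨⟨hx1, hx2⟩, hy1, hy2⟩, rfl⟩, hp⟩)
  · simp only at hx1 hx2 hy1 hy2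
    rcases hx1.eq_or_lt with rfl | hx1
    · exact ⟨Or.inl (rosenTT_iterate_two_fst _ _ _ _), mem_univ _⟩
    · refine absurd ⟨(x + 1, y / (1 - y)), ⟨⟨?_, ?_⟩, ?_, ?_⟩, ?_⟩ hp
      · simp only
        linarith
      · simp only
        linarith
      · exact div_nonneg hy1 (by linarith)
      · simp only
        rw [div_lt_iff₀ (by linarith)]
        nlinarith
      · rw [← rosenTT_iterate_two_sub_one (by linarith) (by linarith) ha ha2 (by linarith),
          add_sub_cancel_right]
  · simp only at hx1 hx2 hy1 hy2
    rcases hx1.eq_or_lt with rfl | hx1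
    · exact ⟨Or.inr (rosenTT_iterate_two_fst _ _ _ _), mem_univ _⟩
    · have h1 : 1 + y ≠ 0 := by linarith
      have hy3 : y / (1 + y) < 1 := by
        rw [div_lt_one (by linarith)]
        linarith
      have hy4 : 0 ≤ y / (1 + y) := div_nonneg hy1 (by linarith)
      refine absurd ⟨(x - 1, y / (1 + y)), ⟨⟨?_, ?_⟩, hy4, ?_⟩, ?_⟩ hp
      · simp only
        linarith
      · simp only
        linarith
      · simp only
        rw [div_lt_iff₀ (by linarith)]
        nlinarith
      · rw [rosenTT_iterate_two_sub_one hx1 hx2 ha ha2 hy3]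
        have h2 : y / (1 + y) / (1 - y / (1 + y)) = y := by
          rw [one_sub_div h1, add_sub_cancel_right, div_div_div_cancel_right₀ h1, div_one]
        rw [h2]
end
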